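/- arXiv:2309.15628 — 4 statements merged into one kernel-verified Lean document; each statement's English description precedes it below -/
import Mathlib

section
/- Let ℓ ≥ 5 be an odd integer. Then the complete graph K_{2ℓ+1} admits an equitably 2-colourable ℓ-cycle decomposition whose 2-colouring has colour classes of sizes ℓ and ℓ+1 (that is, ℓ vertices receive one colour and ℓ+1 vertices receive the other). -/
/-- The edge set of the cycle represented by `c : ZMod n → V`
(vertices listed in cyclic order). -/
def cycEdges {V : Type} {n : ℕ} [NeZero n] (c : ZMod n → V) : Set (Sym2 V) :=
  Set.range fun j => s(c j, c (j + 1))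

/-- The family `cyc` of `n`-cycles is an `n`-cycle decomposition of the graph `G`:
each `cyc i` is an injective cyclic sequence of adjacent vertices, and every edge
of `G` lies on exactly one of the cycles. -/
def IsCycleDecomp {V : Type} {n : ℕ} [NeZero n] (G : SimpleGraph V)
    {ι : Type} (cyc : ι → ZMod n → V) : Prop :=
  (∀ i, Function.Injective (cyc i)) ∧
  (∀ i j, G.Adj (cyc i j) (cyc i (j + 1))) ∧
  (∀ e, e ∈ G.edgeSet ↔ ∃! i, e ∈ cycEdges (cyc i))

/-- Number of vertices of the cycle `c` coloured `true` (red). -/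
def redCount {V : Type} {n : ℕ} [NeZero n] (colour : V → Bool) (c : ZMod n → V) : ℕ :=
  (Finset.univ.filter fun j => colour (c j) = true).card

/-- The cycle `c` is equitably 2-coloured: each colour appears on
`⌊n/2⌋` or `⌈n/2⌉` of its vertices. -/
def IsEquitable {V : Type} {n : ℕ} [NeZero n] (colour : V → Bool) (c : ZMod n → V) : Prop :=
  redCount colour c = n / 2 ∨ redCount colour c = (n + 1) / 2

/-- `G` admits an equitably 2-colourable decomposition into cycles of length `n`. -/
def HasEquitable2Decomp {V : Type} (G : SimpleGraph V) (n : ℕ) [NeZero n] : Prop :=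
  ∃ (ι : Type) (cyc : ι → ZMod n → V) (colour : V → Bool),
    IsCycleDecomp G cyc ∧ ∀ i, IsEquitable colour (cyc i)

section helpers

lemma aux_val_succ (ℓ : ℕ) [NeZero ℓ] (h2 : 2 ≤ ℓ) (j : ZMod ℓ) :
    (j + 1).val = if j.val + 1 = ℓ then 0 else j.val + 1 := by
  have h1 : (1 : ZMod ℓ).val = 1 := by
    rw [ZMod.val_one_eq_one_mod]; exact Nat.mod_eq_of_lt (by omega)
  rw [ZMod.val_add, h1]
  have hj := ZMod.val_lt j
  split_ifs with h
  · rw [h]; exact Nat.mod_self ℓ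
  · exact Nat.mod_eq_of_lt (by omega)

lemma aux_abs (ℓ d : ℕ) (hd : d ≤ ℓ) (x : ZMod (2 * ℓ + 1))
    (h : x = (d : ZMod (2 * ℓ + 1)) ∨ x = -(d : ZMod (2 * ℓ + 1))) :
    x.valMinAbs.natAbs = d := by
  have h0 : ((d : ZMod (2 * ℓ + 1))).valMinAbs.natAbs = d := by
    rw [ZMod.valMinAbs_natCast_of_le_half (by omega)]; simp
  rcases h with h | h
  · rw [h, h0]
  · rw [h, ZMod.natAbs_valMinAbs_neg, h0]

lemma aux_abs_le (ℓ : ℕ) (x : ZMod (2 * ℓ + 1)) : x.valMinAbs.natAbs ≤ ℓ := by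
  have := ZMod.natAbs_valMinAbs_le x
  omega

lemma aux_abs_eq (ℓ : ℕ) (x y : ZMod (2 * ℓ + 1))
    (h : x.valMinAbs.natAbs = y.valMinAbs.natAbs) : x = y ∨ x = -y := by
  rcases Int.natAbs_eq_natAbs_iff.1 h with h | h
  · left; rw [← ZMod.coe_valMinAbs x, h, ZMod.coe_valMinAbs]
  · right; rw [← ZMod.coe_valMinAbs x, h]; push_cast; simp

lemma aux_neg (ℓ : ℕ) (x : ZMod (2 * ℓ + 1)) (h : x = -x) : x = 0 := by
  have h1 : x + x = 0 := by nth_rewrite 1 [h]; simp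
  have h2 : ((2 * ℓ + 1 : ℕ) : ZMod (2 * ℓ + 1)) = 0 := ZMod.natCast_self _
  push_cast at h2
  calc x = (2 * (ℓ : ZMod (2 * ℓ + 1)) + 1) * x - ℓ * (x + x) := by ring
    _ = 0 := by rw [h1, h2]; ring

/-- Decomposition from a base cycle whose differences cover everything. -/
lemma aux_decomp (ℓ : ℕ) [NeZero ℓ] (c : ZMod ℓ → ZMod (2 * ℓ + 1))
    (hinj : Function.Injective c)
    (hd : ∀ d, 1 ≤ d → d ≤ ℓ → ∃ j, (c (j + 1) - c j).valMinAbs.natAbs = d) :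
    IsCycleDecomp (⊤ : SimpleGraph (ZMod (2 * ℓ + 1)))
      (fun (i : ZMod (2 * ℓ + 1)) j => c j + i) := by
  set f : ZMod ℓ → ℕ := fun j => (c (j + 1) - c j).valMinAbs.natAbs with hf
  have himg : Finset.Icc 1 ℓ ⊆ Finset.univ.image f := by
    intro d hd'
    rw [Finset.mem_Icc] at hd'
    obtain ⟨j, hj⟩ := hd d hd'.1 hd'.2
    exact Finset.mem_image.2 ⟨j, Finset.mem_univ _, hj⟩
  have hcard : (Finset.univ.image f).card ≤ ℓ := by
    refine Finset.card_image_le.trans ?_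
    rw [Finset.card_univ, ZMod.card]
  have heq : Finset.Icc 1 ℓ = Finset.univ.image f :=
    Finset.eq_of_subset_of_card_le himg (by simpa using hcard)
  have hfinj : Function.Injective f := by
    have : Set.InjOn f (Finset.univ : Finset (ZMod ℓ)) := by
      apply Finset.card_image_iff.1
      rw [← heq, Finset.card_univ, ZMod.card]; simp
    intro a b hab
    exact this (by simp) (by simp) hab
  have hne : ∀ j, c (j + 1) - c j ≠ 0 := by
    intro j h0
    have : f j ∈ Finset.Icc 1 ℓ := by rw [heq]; exact Finset.mem_image_of_mem _ (Finset.mem_univ _)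
    rw [hf] at this
    simp [h0] at this
  refine ⟨?_, ?_, ?_⟩
  · intro i a b hab
    exact hinj (add_right_cancel hab)
  · intro i j
    rw [SimpleGraph.top_adj]
    intro h
    exact hne j (sub_eq_zero.2 (add_right_cancel h).symm)
  · intro e
    induction e with
    | _ x y =>
    rw [SimpleGraph.mem_edgeSet, SimpleGraph.top_adj]
    constructor
    · intro hxy
      have h1 : 1 ≤ (y - x).valMinAbs.natAbs := by
        by_contra h
        have : (y - x).valMinAbs = 0 := by omega
        rw [ZMod.valMinAbs_eq_zero] at this
        exact hxy (sub_eq_zero.1 this).symm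
      obtain ⟨j, hj⟩ := hd _ h1 (aux_abs_le ℓ _)
      have hex : ∃ i, s(x, y) ∈ cycEdges (fun j => c j + i) := by
        rcases aux_abs_eq ℓ _ _ hj with h | h
        · refine ⟨x - c j, j, ?_⟩
          have e1 : c j + (x - c j) = x := by ring
          have e2 : c (j + 1) + (x - c j) = y := by linear_combination h
          simp only [e1, e2]
        · refine ⟨y - c j, j, ?_⟩
          have e1 : c j + (y - c j) = y := by ring
          have e2 : c (j + 1) + (y - c j) = x := by linear_combination h
          simp only [e1, e2]
          exact Sym2.eq_swap
      obtain ⟨i, hi⟩ := hex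
      refine ⟨i, hi, ?_⟩
      intro i' hi'
      obtain ⟨a, ha⟩ := hi
      obtain ⟨b, hb⟩ := hi'
      have hab : s(c b + i', c (b + 1) + i') = s(c a + i, c (a + 1) + i) := by
        rw [show s(c a + i, c (a + 1) + i) = s(x, y) from ha]; exact hb
      rw [Sym2.eq_iff] at hab
      rcases hab with ⟨h1, h2⟩ | ⟨h1, h2⟩
      · have h3 : c (b + 1) - c b = c (a + 1) - c a := by linear_combination h2 - h1
        have : b = a := hfinj (by simp only [hf]; rw [h3])
        subst this
        exact add_left_cancel h1
      · have h3 : c (b + 1) - c b = -(c (a + 1) - c a) := by linear_combination h2 - h1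
        have : b = a := hfinj (by simp only [hf]; rw [h3, ZMod.natAbs_valMinAbs_neg])
        subst this
        exact absurd (aux_neg ℓ _ h3) (hne b)
    · rintro ⟨i, ⟨j, hj⟩, -⟩ hxy
      subst hxy
      have h := Sym2.eq_iff.1 hj
      have h' : c j + i = x ∧ c (j + 1) + i = x := by tauto
      exact hne j (by linear_combination h'.2 - h'.1)

/-- indicator of even representative -/
def redI {n : ℕ} (x : ZMod n) : ℕ := if x.val % 2 = 0 then 1 else 0

lemma aux_redtot (ℓ : ℕ) : ∑ x : ZMod (2 * ℓ + 1), redI x = ℓ + 1 := by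
  have h1 : ∑ x : ZMod (2 * ℓ + 1), redI x = ∑ x : Fin (2 * ℓ + 1), if x.val % 2 = 0 then 1 else 0 :=
    rfl
  rw [h1, Fin.sum_univ_eq_sum_range (fun x => if x % 2 = 0 then 1 else 0)]
  induction ℓ with
  | zero => rfl
  | succ k ih =>
    rw [show 2 * (k + 1) + 1 = (2 * k + 1) + 1 + 1 by ring, Finset.sum_range_succ,
      Finset.sum_range_succ, ih rfl]
    have e1 : (2 * k + 1) % 2 ≠ 0 := by omega
    have e2 : (2 * k + 1 + 1) % 2 = 0 := by omega
    simp [e2]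

lemma aux_domino (ℓ : ℕ) (hℓ : 1 ≤ ℓ) (x : ZMod (2 * ℓ + 1)) :
    redI x + redI (x + 1) = 1 + if x = -1 then 1 else 0 := by
  have h := aux_val_succ (2 * ℓ + 1) (by omega) x
  have hx := ZMod.val_lt x
  have hm : x = -1 ↔ x.val = 2 * ℓ := by
    constructor
    · intro hx1
      by_contra hne
      rw [if_neg (by omega)] at h
      rw [hx1] at h; simp at h
    · intro hv
      rw [if_pos (by omega), ZMod.val_eq_zero] at h
      exact eq_neg_of_add_eq_zero_left h
  unfold redI
  rw [h]
  by_cases hv : x = -1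
  · rw [if_pos hv]
    have := hm.1 hv
    rw [if_pos (by omega), if_pos (by omega : x.val + 1 = 2 * ℓ + 1)]
    simp
  · rw [if_neg hv]
    have : x.val ≠ 2 * ℓ := fun h => hv (hm.2 h)
    rw [if_neg (by omega : ¬ x.val + 1 = 2 * ℓ + 1)]
    rcases Nat.mod_two_eq_zero_or_one x.val with h0 | h0
    · rw [if_pos h0, if_neg (by omega)]
    · rw [if_neg (by omega), if_pos (by omega)]

lemma aux_equit (m : ℕ) (c : Fin (2 * m + 1) → ZMod (2 * (2 * m + 1) + 1))
    (s : Fin (m + 1) → ZMod (2 * (2 * m + 1) + 1))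
    (hc : Function.Injective c) (hs : Function.Injective s)
    (h1 : ∀ j k, c j ≠ s k) (h2 : ∀ j k, c j ≠ s k + 1) (h3 : ∀ k k', s k ≠ s k' + 1)
    (t : ZMod (2 * (2 * m + 1) + 1)) :
    ∑ j, redI (c j + t) = m ∨ ∑ j, redI (c j + t) = m + 1 := by
  let φ : Fin (2 * m + 1) ⊕ (Fin (m + 1) ⊕ Fin (m + 1)) → ZMod (2 * (2 * m + 1) + 1) :=
    Sum.elim (fun j => c j + t) (Sum.elim (fun k => s k + t) (fun k => s k + 1 + t))
  have hφ : Function.Injective φ := by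
    apply Function.Injective.sumElim
    · intro a b h; exact hc (add_right_cancel h)
    · apply Function.Injective.sumElim
      · intro a b h; exact hs (add_right_cancel h)
      · intro a b h; exact hs (add_right_cancel (add_right_cancel h))
      · intro a b h; exact h3 a b (add_right_cancel h)
    · rintro a (b | b) h
      · exact h1 a b (add_right_cancel h)
      · exact h2 a b (add_right_cancel h)
  have hbij : Function.Bijective φ := by
    rw [Fintype.bijective_iff_injective_and_card]
    refine ⟨hφ, ?_⟩
    simp [ZMod.card]
    ring
  have hsum := Function.Bijective.sum_comp hbij redI
  rw [aux_redtot, Fintype.sum_sum_type, Fintype.sum_sum_type] at hsum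
  simp only [φ, Sum.elim_inl, Sum.elim_inr] at hsum
  rw [← Finset.sum_add_distrib] at hsum
  have e : ∀ k, redI (s k + t) + redI (s k + 1 + t) = 1 + if s k + t = -1 then 1 else 0 := by
    intro k
    rw [← aux_domino _ (by omega), add_right_comm]
  simp only [e] at hsum
  rw [Finset.sum_add_distrib] at hsum
  have hle : ∑ k, (if s k + t = -1 then 1 else 0) ≤ 1 := by
    rw [← Finset.card_filter, Finset.card_le_one]
    intro a ha b hb
    simp only [Finset.mem_filter, Finset.mem_univ, true_and] at ha hb
    exact hs (add_right_cancel (ha.trans hb.symm))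
  simp at hsum hle
  omega

lemma aux_main (m : ℕ) (hm : 1 ≤ m) (c s : ℕ → ℕ)
    (hc : ∀ j < 2 * m + 1, c j < 4 * m + 3)
    (hcinj : ∀ j < 2 * m + 1, ∀ j' < 2 * m + 1, c j = c j' → j = j')
    (hs : ∀ k < m + 1, s k + 1 < 4 * m + 3)
    (hsinj : ∀ k < m + 1, ∀ k' < m + 1, s k = s k' → k = k')
    (hss : ∀ k < m + 1, ∀ k' < m + 1, s k ≠ s k' + 1)
    (hcs : ∀ j < 2 * m + 1, ∀ k < m + 1, c j ≠ s k ∧ c j ≠ s k + 1)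
    (hd : ∀ d, 1 ≤ d → d ≤ 2 * m + 1 → ∃ j, j < 2 * m + 1 ∧
      ∃ j', j' = (if j + 1 = 2 * m + 1 then 0 else j + 1) ∧
      (c j' = c j + d ∨ c j = c j' + d ∨ c j' + (4 * m + 3) = c j + d ∨
        c j + (4 * m + 3) = c j' + d)) (ℓ : ℕ) (hl : ℓ = 2 * m + 1) [NeZero ℓ] :
    ∃ (ι : Type) (cyc : ι → ZMod ℓ → Fin (2 * ℓ + 1)) (colour : Fin (2 * ℓ + 1) → Bool),
      IsCycleDecomp (⊤ : SimpleGraph (Fin (2 * ℓ + 1))) cyc ∧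
      (∀ i, IsEquitable colour (cyc i)) ∧
      ((Finset.univ.filter fun x => colour x = true).card = ℓ ∨
        (Finset.univ.filter fun x => colour x = true).card = ℓ + 1) := by
  subst hl
  set n := 2 * (2 * m + 1) + 1 with hn
  have hn' : n = 4 * m + 3 := by omega
  have castinj : ∀ a b : ℕ, a < 4 * m + 3 → b < 4 * m + 3 → ((a : ℕ) : ZMod n) = b → a = b := by
    intro a b ha hb h
    rw [ZMod.natCast_eq_natCast_iff'] at h
    rwa [Nat.mod_eq_of_lt (by omega), Nat.mod_eq_of_lt (by omega)] at h
  let C : ZMod (2 * m + 1) → ZMod n := fun j => (c j.val : ZMod n)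
  have hC : Function.Injective C := by
    intro a b h
    have ha := ZMod.val_lt a
    have hb := ZMod.val_lt b
    exact ZMod.val_injective _ (hcinj _ ha _ hb (castinj _ _ (hc _ ha) (hc _ hb) h))
  have hdec : IsCycleDecomp (⊤ : SimpleGraph (ZMod n)) (fun (i : ZMod n) j => C j + i) := by
    apply aux_decomp _ C hC
    intro d h1 h2
    obtain ⟨j, hj, j', hj', h⟩ := hd d h1 h2
    refine ⟨(j : ZMod (2 * m + 1)), aux_abs _ d h2 _ ?_⟩
    have v0 : ((j : ZMod (2 * m + 1))).val = j := ZMod.val_cast_of_lt hj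
    have v1 : ((j : ZMod (2 * m + 1)) + 1).val = j' := by
      rw [aux_val_succ _ (by omega), v0, hj']
    simp only [C, v0, v1]
    have hz : ((4 * m + 3 : ℕ) : ZMod n) = 0 := by rw [← hn']; exact ZMod.natCast_self n
    rcases h with h | h | h | h
    all_goals have h' := congrArg (fun x : ℕ => (x : ZMod n)) h
    all_goals simp only [Nat.cast_add (c _), hz] at h'
    · left; linear_combination h'
    · right; linear_combination -h'
    · left; linear_combination h'
    · right; linear_combination -h'
  refine ⟨ZMod n, fun i j => C j + i, fun x => decide (x.val % 2 = 0), hdec, ?_, ?_⟩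
  · intro t
    have key := aux_equit m (fun j => (c j.val : ZMod n)) (fun k => (s k.val : ZMod n))
      (fun a b h => Fin.ext (hcinj _ a.2 _ b.2 (castinj _ _ (hc _ a.2) (hc _ b.2) h)))
      (fun a b h => Fin.ext (hsinj _ a.2 _ b.2
        (castinj _ _ (by have := hs _ a.2; omega) (by have := hs _ b.2; omega) h)))
      (fun j k h => (hcs _ j.2 _ k.2).1
        (castinj _ _ (hc _ j.2) (by have := hs _ k.2; omega) h))
      (fun j k h => (hcs _ j.2 _ k.2).2
        (castinj _ _ (hc _ j.2) (hs _ k.2) (by push_cast; exact h)))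
      (fun k k' h => hss _ k.2 _ k'.2
        (castinj _ _ (by have := hs _ k.2; omega) (hs _ k'.2) (by push_cast; exact h))) t
    have e : redCount (fun x : Fin n => decide (x.val % 2 = 0)) (fun j => C j + t)
        = ∑ j : Fin (2 * m + 1), redI ((c j.val : ZMod n) + t) := by
      unfold redCount
      rw [Finset.card_filter]
      have : ∀ j : ZMod (2 * m + 1),
          (if decide ((C j + t : Fin n).val % 2 = 0) = true then 1 else 0) = redI (C j + t) := by
        intro j
        simp only [decide_eq_true_eq]
        rfl
      refine (Finset.sum_congr rfl (fun j _ => this j)).trans ?_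
      rfl
    unfold IsEquitable
    rw [e]
    rcases key with key | key
    · left; rw [key]; omega
    · right; rw [key]; omega
  · right
    rw [Finset.card_filter]
    have := aux_redtot (2 * m + 1)
    rw [← this]
    refine Finset.sum_congr rfl (fun x _ => ?_)
    simp only [decide_eq_true_eq]
    rfl

end helpers

set_option maxHeartbeats 4000000 in
theorem stmt2 (ℓ : ℕ) (hℓ : 5 ≤ ℓ) (hodd : Odd ℓ) :
    letI : NeZero ℓ := ⟨by omega⟩
    ∃ (ι : Type) (cyc : ι → ZMod ℓ → Fin (2 * ℓ + 1)) (colour : Fin (2 * ℓ + 1) → Bool),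
      IsCycleDecomp (⊤ : SimpleGraph (Fin (2 * ℓ + 1))) cyc ∧
      (∀ i, IsEquitable colour (cyc i)) ∧
      ((Finset.univ.filter fun x => colour x = true).card = ℓ ∨
        (Finset.univ.filter fun x => colour x = true).card = ℓ + 1) := by
  have : NeZero ℓ := ⟨by omega⟩
  by_cases h5 : ℓ = 5
  · refine aux_main 2 (by omega) (fun j => [0, 4, 5, 3, 6].getD j 0)
      (fun k => [1, 7, 9].getD k 0) ?_ ?_ ?_ ?_ ?_ ?_ ?_ ℓ (by omega)
    · decide
    · decide
    · decide
    · decide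
    · decide
    · decide
    · intro d h1 h2
      have : ∀ d < 6, 1 ≤ d → ∃ j, j < 5 ∧ ([0, 4, 5, 3, 6].getD (if j + 1 = 5 then 0 else j + 1) 0
        = [0, 4, 5, 3, 6].getD j 0 + d ∨ [0, 4, 5, 3, 6].getD j 0 =
        [0, 4, 5, 3, 6].getD (if j + 1 = 5 then 0 else j + 1) 0 + d ∨
        [0, 4, 5, 3, 6].getD (if j + 1 = 5 then 0 else j + 1) 0 + 11 = [0, 4, 5, 3, 6].getD j 0 + d ∨
        [0, 4, 5, 3, 6].getD j 0 + 11 =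
          [0, 4, 5, 3, 6].getD (if j + 1 = 5 then 0 else j + 1) 0 + d) := by decide
      obtain ⟨j, hj, h⟩ := this d (by omega) h1
      exact ⟨j, hj, _, rfl, h⟩
  by_cases h9 : ℓ = 9
  · refine aux_main 4 (by omega) (fun j => [0, 1, 18, 2, 7, 3, 11, 4, 10].getD j 0)
      (fun k => [5, 8, 12, 14, 16].getD k 0) ?_ ?_ ?_ ?_ ?_ ?_ ?_ ℓ (by omega)
    · decide
    · decide
    · decide
    · decide
    · decide
    · decide
    · intro d h1 h2
      have : ∀ d < 10, 1 ≤ d → ∃ j, j < 9 ∧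
        ([0, 1, 18, 2, 7, 3, 11, 4, 10].getD (if j + 1 = 9 then 0 else j + 1) 0
        = [0, 1, 18, 2, 7, 3, 11, 4, 10].getD j 0 + d ∨ [0, 1, 18, 2, 7, 3, 11, 4, 10].getD j 0 =
        [0, 1, 18, 2, 7, 3, 11, 4, 10].getD (if j + 1 = 9 then 0 else j + 1) 0 + d ∨
        [0, 1, 18, 2, 7, 3, 11, 4, 10].getD (if j + 1 = 9 then 0 else j + 1) 0 + 19 =
          [0, 1, 18, 2, 7, 3, 11, 4, 10].getD j 0 + d ∨
        [0, 1, 18, 2, 7, 3, 11, 4, 10].getD j 0 + 19 =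
          [0, 1, 18, 2, 7, 3, 11, 4, 10].getD (if j + 1 = 9 then 0 else j + 1) 0 + d) := by decide
      obtain ⟨j, hj, h⟩ := this d (by omega) h1
      exact ⟨j, hj, _, rfl, h⟩
  obtain ⟨m, hm⟩ := hodd
  rcases Nat.even_or_odd' m with ⟨q, hq | hq⟩
  · refine aux_main m (by omega)
      (fun j => if j % 2 = 0 then (if j ≤ 2 * q + 4 then j / 2 else (3 * ℓ + 1 + j) / 2)
        else (if j ≤ 2 * q + 1 then 2 * q + 3 - (j - 1) / 2 else 6 * q + 3 - (j - 1) / 2))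
      (fun k => if k < q then 2 * q + 4 + 2 * k else 5 * q + 3 + 2 * (k - q))
      ?_ ?_ ?_ ?_ ?_ ?_ ?_ ℓ hm
    · intro j hj; split_ifs <;> omega
    · intro j hj j' hj'; split_ifs <;> omega
    · intro k hk; split_ifs <;> omega
    · intro k hk k' hk'; split_ifs <;> omega
    · intro k hk k' hk'; split_ifs <;> omega
    · intro j hj k hk; split_ifs <;> omega
    · intro d h1 h2
      refine ⟨if d = 1 then 4 * q else if d ≤ 2 * q + 3 then 2 * q + 3 - d else
        if d ≤ 4 * q - 2 then d + 1 else 6 * q + 3 - d, ?_, _, rfl, ?_⟩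
      · split_ifs <;> omega
      · generalize hj : (if d = 1 then 4 * q else if d ≤ 2 * q + 3 then 2 * q + 3 - d else
          if d ≤ 4 * q - 2 then d + 1 else 6 * q + 3 - d) = j
        generalize hj' : (if j + 1 = 2 * m + 1 then 0 else j + 1) = j'
        split_ifs at hj hj' ⊢ <;> omega
  · refine aux_main m (by omega)
      (fun j => if j % 2 = 0 then (if j ≤ 2 * q + 2 then j / 2 else (3 * ℓ + 1 + j) / 2)
        else (if j ≤ 2 * q - 1 then ℓ - (j - 1) / 2 else 2 * ℓ - (j - 1) / 2))
      (fun k => if k < q + 1 then q + 2 + 2 * k else 4 * q + 4 + 2 * (k - q - 1))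
      ?_ ?_ ?_ ?_ ?_ ?_ ?_ ℓ hm
    · intro j hj; split_ifs <;> omega
    · intro j hj j' hj'; split_ifs <;> omega
    · intro k hk; split_ifs <;> omega
    · intro k hk k' hk'; split_ifs <;> omega
    · intro k hk k' hk'; split_ifs <;> omega
    · intro j hj k hk; split_ifs <;> omega
    · intro d h1 h2
      refine ⟨if d = 1 then 4 * q + 2 else if d ≤ 2 * q then d + 2 * q + 1 else
        if d ≤ 2 * q + 3 then d - 1 else ℓ - d, ?_, _, rfl, ?_⟩
      · split_ifs <;> omega
      · generalize hj : (if d = 1 then 4 * q + 2 else if d ≤ 2 * q then d + 2 * q + 1 else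
          if d ≤ 2 * q + 3 then d - 1 else ℓ - d) = j
        generalize hj' : (if j + 1 = 2 * m + 1 then 0 else j + 1) = j'
        split_ifs at hj hj' ⊢ <;> omega
end

section
/- Let ℓ ≥ 7 be an odd integer. Then the complete graph K_{4ℓ+1} admits an equitably 2-colourable ℓ-cycle decomposition whose 2-colouring has colour classes of sizes 2ℓ and 2ℓ+1 (that is, 2ℓ vertices receive one colour and 2ℓ+1 vertices receive the other). -/
def shf (N x t : ℕ) : ℕ := if x + t < N then x + t else x + t - N

def nxt (l j : ℕ) : ℕ := if j + 1 = l then 0 else j + 1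

lemma shf_lt {N x t : ℕ} (hx : x < N) (ht : t < N) : shf N x t < N := by
  unfold shf; split_ifs <;> omega

lemma count_aux (N t : ℕ) (hN : N % 2 = 1) (X C : ℕ → ℕ) (l : ℕ)
    (hmono : ∀ r, r + 1 < l → X r < X (r + 1)) (hpar : ∀ r, r < l → X r % 2 = r % 2)
    (hC0 : C 0 = 0) (hC : ∀ n, C (n + 1) = C n + if shf N (X n) t % 2 = 0 then 1 else 0) :
    ∀ n, n ≤ l →
      ((∀ r, r + 1 = n → X r + t < N) ∧
        ((t % 2 = 0 ∧ C n = (n + 1) / 2) ∨ (t % 2 = 1 ∧ C n = n / 2))) ∨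
      ((∃ r, r + 1 = n ∧ N ≤ X r + t) ∧
        ((t % 2 = 0 ∧ (C n = n / 2 ∨ C n = n / 2 + 1)) ∨
        (t % 2 = 1 ∧ (C n = (n + 1) / 2 ∨ C n + 1 = (n + 1) / 2)))) := by
  intro n
  induction n with
  | zero => intro _; left; exact ⟨by omega, by omega⟩
  | succ n ih =>
    intro hn
    have hp := hpar n (by omega)
    have hc := hC n
    unfold shf at hc
    by_cases hw : X n + t < N
    · rw [if_pos hw] at hc
      left
      refine ⟨fun r hr => by obtain rfl : r = n := by omega
                             exact hw, ?_⟩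
      rcases ih (by omega) with ⟨_, h⟩ | ⟨⟨r, hr, h1⟩, _⟩
      · split_ifs at hc <;> omega
      · exfalso
        subst hr
        have := hmono r (by omega)
        omega
    · rw [if_neg hw] at hc
      right
      refine ⟨⟨n, rfl, by omega⟩, ?_⟩
      rcases ih (by omega) with ⟨_, h⟩ | ⟨_, h⟩
      · split_ifs at hc <;> omega
      · split_ifs at hc <;> omega

lemma count_main (N t : ℕ) (hN : N % 2 = 1) (X : ℕ → ℕ) (l : ℕ) (hl : l % 2 = 1)
    (hmono : ∀ r, r + 1 < l → X r < X (r + 1)) (hpar : ∀ r, r < l → X r % 2 = r % 2) :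
    ((Finset.range l).filter fun r => shf N (X r) t % 2 = 0).card = l / 2 ∨
    ((Finset.range l).filter fun r => shf N (X r) t % 2 = 0).card = (l + 1) / 2 := by
  have := count_aux N t hN X
    (fun n => ((Finset.range n).filter fun r => shf N (X r) t % 2 = 0).card) l hmono hpar
    (by simp) (by
      intro n
      simp only [Finset.range_add_one, Finset.filter_insert]
      split_ifs
      · rw [Finset.card_insert_of_notMem (by simp)]
      · simp) l le_rfl
  rcases this with ⟨_, h⟩ | ⟨_, h⟩
  · omega
  · omega

lemma val_succ {l : ℕ} (hl : 1 < l) [NeZero l] (j : ZMod l) : (j + 1).val = nxt l j.val := by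
  have h1 : (1 : ZMod l).val = 1 := by
    have : Fact (1 < l) := ⟨hl⟩
    exact ZMod.val_one l
  have hj := ZMod.val_lt j
  rw [ZMod.val_add, h1]
  unfold nxt
  split_ifs with h
  · rw [h, Nat.mod_self]
  · exact Nat.mod_eq_of_lt (by omega)

lemma strict_of {X : ℕ → ℕ} {l : ℕ} (hmono : ∀ r, r + 1 < l → X r < X (r + 1)) :
    ∀ s r, r < s → s < l → X r < X s := by
  intro s
  induction s with
  | zero => intro r h; omega
  | succ s ih =>
    intro r h hs
    have h1 := hmono s hs
    rcases Nat.lt_or_ge r s with h2 | h2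
    · exact lt_trans (ih r h2 (by omega)) h1
    · obtain rfl : r = s := by omega
      exact h1

def Diff (N x y d : ℕ) : Prop := x + d = y ∨ y + d = x ∨ x + N = y + d ∨ y + N = x + d

/-- The reduction to two base cycles. -/
lemma key (l : ℕ) [NeZero l] (hl3 : 3 ≤ l) (hl : l % 2 = 1) (ρ X : Bool → ℕ → ℕ)
    (hρ : ∀ b j, j < l → ρ b j < l)
    (hinj : ∀ b i j, i < l → j < l → ρ b i = ρ b j → i = j)
    (hmono : ∀ b r, r + 1 < l → X b r < X b (r + 1))
    (hpar : ∀ b r, r < l → X b r % 2 = r % 2)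
    (hlt : ∀ b r, r < l → X b r < 4 * l + 1)
    (hcov : ∀ d, 1 ≤ d → d ≤ 2 * l → ∃ b j, j < l ∧
      Diff (4 * l + 1) (X b (ρ b j)) (X b (ρ b (nxt l j))) d) :
    ∃ (ι : Type) (cyc : ι → ZMod l → Fin (4 * l + 1)) (colour : Fin (4 * l + 1) → Bool),
      IsCycleDecomp (⊤ : SimpleGraph (Fin (4 * l + 1))) cyc ∧
      (∀ i, IsEquitable colour (cyc i)) ∧
      ((Finset.univ.filter fun x => colour x = true).card = 2 * l ∨
        (Finset.univ.filter fun x => colour x = true).card = 2 * l + 1) := by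
  have hxlt : ∀ b (j : ZMod l), X b (ρ b j.val) < 4 * l + 1 := fun b j =>
    hlt _ _ (hρ _ _ (ZMod.val_lt j))
  let cyc : Bool × Fin (4 * l + 1) → ZMod l → Fin (4 * l + 1) := fun i j =>
    ⟨shf (4 * l + 1) (X i.1 (ρ i.1 j.val)) i.2.val, shf_lt (hxlt _ _) i.2.isLt⟩
  have hcycinj : ∀ i, Function.Injective (cyc i) := by
    rintro ⟨b, t⟩ j j' h
    have h1 : shf (4 * l + 1) (X b (ρ b j.val)) t.val = shf (4 * l + 1) (X b (ρ b j'.val)) t.val :=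
      congrArg Fin.val h
    have a1 := hxlt b j
    have a2 := hxlt b j'
    have a3 := t.isLt
    have h2 : X b (ρ b j.val) = X b (ρ b j'.val) := by
      unfold shf at h1
      split_ifs at h1 <;> omega
    have r1 := hρ b _ (ZMod.val_lt j)
    have r2 := hρ b _ (ZMod.val_lt j')
    have h3 : ρ b j.val = ρ b j'.val := by
      rcases Nat.lt_trichotomy (ρ b j.val) (ρ b j'.val) with h | h | h
      · have := strict_of (hmono b) _ _ h r2; omega
      · exact h
      · have := strict_of (hmono b) _ _ h r1; omega
    exact ZMod.val_injective l (hinj b _ _ (ZMod.val_lt j) (ZMod.val_lt j') h3)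
  have hne : ∀ i j, cyc i j ≠ cyc i (j + 1) := by
    intro i j h
    have h2 := congrArg ZMod.val (hcycinj i h)
    rw [val_succ (by omega)] at h2
    unfold nxt at h2
    split_ifs at h2 <;> omega
  refine ⟨Bool × Fin (4 * l + 1), cyc, fun v => decide (v.val % 2 = 0),
    ⟨hcycinj, fun i j => by simpa using hne i j, ?_⟩, ?_, ?_⟩
  · -- edges
    let F : (Bool × Fin (4 * l + 1)) × ZMod l → (⊤ : SimpleGraph (Fin (4 * l + 1))).edgeSet :=
      fun p => ⟨s(cyc p.1 p.2, cyc p.1 (p.2 + 1)), by simpa using hne p.1 p.2⟩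
    have key1 : ∀ u v : Fin (4 * l + 1), u.val < v.val → ∃ i j,
        s(cyc i j, cyc i (j + 1)) = s(u, v) := by
      intro u v huv
      have hv := v.isLt
      obtain ⟨b, j, hj, hD⟩ : ∃ b j, j < l ∧
          Diff (4 * l + 1) (X b (ρ b j)) (X b (ρ b (nxt l j))) (v.val - u.val) := by
        by_cases hd : v.val - u.val ≤ 2 * l
        · exact hcov _ (by omega) hd
        · obtain ⟨b, j, hj, h⟩ := hcov (4 * l + 1 - (v.val - u.val)) (by omega) (by omega)
          refine ⟨b, j, hj, ?_⟩
          unfold Diff at h ⊢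
          omega
      have hjv : ((j : ZMod l)).val = j := ZMod.val_cast_of_lt hj
      have hjs : ((j : ZMod l) + 1).val = nxt l j := by rw [val_succ (by omega), hjv]
      have a1 := hxlt b (j : ZMod l)
      have a2 := hxlt b ((j : ZMod l) + 1)
      rw [hjv] at a1
      rw [hjs] at a2
      have hor : ∃ t : ℕ, t < 4 * l + 1 ∧
          ((shf (4 * l + 1) (X b (ρ b j)) t = u.val ∧
            shf (4 * l + 1) (X b (ρ b (nxt l j))) t = v.val) ∨
          (shf (4 * l + 1) (X b (ρ b j)) t = v.val ∧
            shf (4 * l + 1) (X b (ρ b (nxt l j))) t = u.val)) := by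
        generalize X b (ρ b j) = x at *
        generalize X b (ρ b (nxt l j)) = y at *
        have hsh : ∀ z w, z < 4 * l + 1 → w < 4 * l + 1 →
            shf (4 * l + 1) z (if z ≤ w then w - z else w + (4 * l + 1) - z) = w := by
          intro z w hz hw
          unfold shf
          split_ifs <;> omega
        have hu := u.isLt
        by_cases hc : x + (v.val - u.val) = y ∨ x + (v.val - u.val) = y + (4 * l + 1)
        · refine ⟨if x ≤ u.val then u.val - x else u.val + (4 * l + 1) - x, ?_, Or.inl ⟨hsh _ _ a1 hu, ?_⟩⟩
          · split_ifs <;> omega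
          · unfold shf
            split_ifs <;> omega
        · refine ⟨if y ≤ u.val then u.val - y else u.val + (4 * l + 1) - y, ?_, Or.inr ⟨?_, hsh _ _ a2 hu⟩⟩
          · split_ifs <;> omega
          · unfold Diff at hD
            unfold shf
            split_ifs <;> omega
      obtain ⟨t, ht, h⟩ := hor
      refine ⟨(b, ⟨t, ht⟩), (j : ZMod l), ?_⟩
      rcases h with ⟨h1, h2⟩ | ⟨h1, h2⟩
      · have e1 : cyc (b, ⟨t, ht⟩) (j : ZMod l) = u := by
          apply Fin.ext; simp only [cyc, hjv]; exact h1
        have e2 : cyc (b, ⟨t, ht⟩) ((j : ZMod l) + 1) = v := by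
          apply Fin.ext; simp only [cyc, hjs]; exact h2
        rw [e1, e2]
      · have e1 : cyc (b, ⟨t, ht⟩) (j : ZMod l) = v := by
          apply Fin.ext; simp only [cyc, hjv]; exact h1
        have e2 : cyc (b, ⟨t, ht⟩) ((j : ZMod l) + 1) = u := by
          apply Fin.ext; simp only [cyc, hjs]; exact h2
        rw [e1, e2, Sym2.eq_swap]
    have hsurj : Function.Surjective F := by
      rintro ⟨e, he⟩
      induction e using Sym2.ind with
      | _ u v =>
        have huv : u ≠ v := by simpa using he
        have huv' : u.val ≠ v.val := fun h => huv (Fin.ext h)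
        rcases Nat.lt_or_gt_of_ne huv' with h | h
        · obtain ⟨i, j, h⟩ := key1 u v h
          exact ⟨(i, j), Subtype.ext h⟩
        · obtain ⟨i, j, h⟩ := key1 v u h
          exact ⟨(i, j), Subtype.ext (h.trans Sym2.eq_swap)⟩
    have hcard : Fintype.card ((Bool × Fin (4 * l + 1)) × ZMod l) =
        Fintype.card (⊤ : SimpleGraph (Fin (4 * l + 1))).edgeSet := by
      rw [← SimpleGraph.edgeFinset_card, SimpleGraph.card_edgeFinset_top_eq_card_choose_two]
      simp only [Fintype.card_prod, Fintype.card_bool, Fintype.card_fin, ZMod.card]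
      rw [Nat.choose_two_right, Nat.add_sub_cancel]
      symm
      apply Nat.div_eq_of_eq_mul_left (by norm_num)
      ring
    have hFinj : Function.Injective F :=
      ((Fintype.bijective_iff_surjective_and_card F).2 ⟨hsurj, hcard⟩).1
    intro e
    constructor
    · intro he
      obtain ⟨⟨i, j⟩, hij⟩ := hsurj ⟨e, he⟩
      refine ⟨i, ⟨j, congrArg Subtype.val hij⟩, ?_⟩
      rintro i' ⟨j', hij'⟩
      have : F (i', j') = F (i, j) := by
        rw [hij]; exact Subtype.ext hij'
      exact congrArg Prod.fst (hFinj this)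
    · rintro ⟨i, ⟨j, hj⟩, _⟩
      rw [← hj]
      simpa using hne i j
  · rintro ⟨b, t⟩
    have hm := count_main (4 * l + 1) t.val (by omega) (X b) l hl (hmono b) (hpar b)
    have hE : redCount (fun v : Fin (4 * l + 1) => decide (v.val % 2 = 0)) (cyc (b, t)) =
        ((Finset.range l).filter fun r => shf (4 * l + 1) (X b r) t.val % 2 = 0).card := by
      have hi : Function.Injective (fun j : ZMod l => ρ b j.val) := fun i j h =>
        ZMod.val_injective l (hinj b _ _ (ZMod.val_lt i) (ZMod.val_lt j) h)
      have himg : Finset.univ.image (fun j : ZMod l => ρ b j.val) = Finset.range l := by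
        apply Finset.eq_of_subset_of_card_le
        · intro r hr
          simp only [Finset.mem_image, Finset.mem_univ, true_and] at hr
          obtain ⟨j, rfl⟩ := hr
          exact Finset.mem_range.2 (hρ b _ (ZMod.val_lt j))
        · rw [Finset.card_image_of_injective _ hi]
          simp [ZMod.card]
      rw [← himg, Finset.filter_image, Finset.card_image_of_injective _ hi]
      unfold redCount
      simp only [cyc, decide_eq_true_eq]
    unfold IsEquitable
    rw [hE]
    exact hm
  · right
    have hi : Function.Injective
        (fun k : Fin (2 * l + 1) => (⟨2 * k.val, by omega⟩ : Fin (4 * l + 1))) := by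
      intro a b h
      have := congrArg Fin.val h
      simp only at this
      exact Fin.ext (by omega)
    have himg : (Finset.univ.filter fun x : Fin (4 * l + 1) => decide (x.val % 2 = 0) = true) =
        Finset.univ.image
          (fun k : Fin (2 * l + 1) => (⟨2 * k.val, by omega⟩ : Fin (4 * l + 1))) := by
      ext x
      simp only [Finset.mem_filter, Finset.mem_univ, true_and, Finset.mem_image, decide_eq_true_eq]
      constructor
      · intro h
        exact ⟨⟨x.val / 2, by omega⟩, Fin.ext (by simp only; omega)⟩
      · rintro ⟨k, rfl⟩
        simp only; omega
    rw [himg, Finset.card_image_of_injective _ hi]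
    simp

def XX1 (m r : ℕ) : ℕ := if r ≤ m then r else r + 2 * m
def R1 (m j : ℕ) : ℕ := if j % 2 = 0 then j / 2 else 2 * m - j / 2

/-- second base cycle, `m` odd -/
def XX3 (m r : ℕ) : ℕ := if 2 * r + 3 ≤ m then r else if r + 4 ≤ 2 * m then r + 2 else
  if r + 3 = 2 * m then 2 * m + 3 else if r + 2 = 2 * m then 4 * m + 2 else
  if r + 1 = 2 * m then 4 * m + 3 else 5 * m + 1
def R3 (m j : ℕ) : ℕ := if j + 4 ≤ 2 * m then (if j % 2 = 0 then j / 2 else 2 * m - 4 - j / 2) else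
  if j + 3 = 2 * m then 2 * m else if j + 2 = 2 * m then 2 * m - 2 else
  if j + 1 = 2 * m then 2 * m - 3 else 2 * m - 1

/-- second base cycle, `m` even -/
def XX2 (m r : ℕ) : ℕ := if 2 * r + 2 ≤ m then r else if r + 2 ≤ 2 * m then r + 2 else
  if r + 1 = 2 * m then 5 * m + 3 else 5 * m + 4
def R2 (m j : ℕ) : ℕ := if j + 3 ≤ 2 * m then (if j % 2 = 0 then j / 2 else 2 * m - 2 - j / 2) else
  if j + 2 = 2 * m then 2 * m - 1 else if j + 1 = 2 * m then 2 * m else m - 1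

lemma cov1 (m d : ℕ) (h1 : m = d ∨ 2 * m + 1 ≤ d ∧ d ≤ 4 * m) : ∃ j, j < 2 * m + 1 ∧
    Diff (4 * (2 * m + 1) + 1) (XX1 m (R1 m j)) (XX1 m (R1 m (nxt (2 * m + 1) j))) d := by
  rcases h1 with h | ⟨h, h'⟩
  · refine ⟨2 * m, by omega, ?_⟩
    unfold Diff nxt XX1 R1
    split_ifs <;> omega
  · refine ⟨4 * m - d, by omega, ?_⟩
    unfold Diff nxt XX1 R1
    split_ifs <;> omega

lemma xr2 (m j : ℕ) (hm : m % 2 = 0) (hm4 : 4 ≤ m) (hj : j < 2 * m + 1) : XX2 m (R2 m j) =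
    if j + 3 ≤ 2 * m then (if j % 2 = 0 then (if j + 2 ≤ m then j / 2 else j / 2 + 2) else 2 * m - j / 2)
    else if j + 2 = 2 * m then 5 * m + 3 else if j + 1 = 2 * m then 5 * m + 4 else m + 1 := by
  unfold XX2 R2
  split_ifs <;> omega

lemma xr3 (m j : ℕ) (hm : m % 2 = 1) (hm4 : 3 ≤ m) (hj : j < 2 * m + 1) : XX3 m (R3 m j) =
    if j + 4 ≤ 2 * m then (if j % 2 = 0 then (if j + 3 ≤ m then j / 2 else j / 2 + 2)
      else 2 * m - 2 - j / 2)
    else if j + 3 = 2 * m then 5 * m + 1 else if j + 2 = 2 * m then 4 * m + 2 else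
    if j + 1 = 2 * m then 2 * m + 3 else 4 * m + 3 := by
  unfold XX3 R3
  split_ifs <;> omega

lemma nxt_lt {l j : ℕ} (h : j < l) : nxt l j < l := by
  unfold nxt; split_ifs <;> omega

lemma cov2 (m d : ℕ) (hm : m % 2 = 0) (hm4 : 4 ≤ m)
    (hd : 1 ≤ d) (hd' : d ≤ 4 * m + 2)
    (h1 : ¬ (m = d ∨ 2 * m + 1 ≤ d ∧ d ≤ 4 * m)) : ∃ j, j < 2 * m + 1 ∧
    Diff (4 * (2 * m + 1) + 1) (XX2 m (R2 m j)) (XX2 m (R2 m (nxt (2 * m + 1) j))) d := by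
  have main : ∀ j, j < 2 * m + 1 → (
      (j + 2 ≤ m ∧ j + d = 2 * m) ∨ (m ≤ j + 1 ∧ j + 4 ≤ 2 * m ∧ j + d = 2 * m - 2) ∨
      (j + 3 = 2 * m ∧ d = 4 * m + 1) ∨ (j + 2 = 2 * m ∧ d = 1) ∨
      (j + 1 = 2 * m ∧ d = 4 * m + 2) ∨ (j = 2 * m ∧ d = m + 1)) →
      Diff (4 * (2 * m + 1) + 1) (XX2 m (R2 m j)) (XX2 m (R2 m (nxt (2 * m + 1) j))) d := by
    intro j hj h
    rw [xr2 m _ hm hm4 hj, xr2 m _ hm hm4 (nxt_lt hj)]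
    unfold Diff nxt
    split_ifs <;> omega
  have : ∃ j, j < 2 * m + 1 ∧ (
      (j + 2 ≤ m ∧ j + d = 2 * m) ∨ (m ≤ j + 1 ∧ j + 4 ≤ 2 * m ∧ j + d = 2 * m - 2) ∨
      (j + 3 = 2 * m ∧ d = 4 * m + 1) ∨ (j + 2 = 2 * m ∧ d = 1) ∨
      (j + 1 = 2 * m ∧ d = 4 * m + 2) ∨ (j = 2 * m ∧ d = m + 1)) := by
    by_cases a1 : d = 4 * m + 1
    · exact ⟨2 * m - 3, by omega, by omega⟩
    by_cases a2 : d = 1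
    · exact ⟨2 * m - 2, by omega, by omega⟩
    by_cases a3 : d = 4 * m + 2
    · exact ⟨2 * m - 1, by omega, by omega⟩
    by_cases a4 : d = m + 1
    · exact ⟨2 * m, by omega, by omega⟩
    by_cases a5 : d < m
    · exact ⟨2 * m - 2 - d, by omega, by omega⟩
    · exact ⟨2 * m - d, by omega, by omega⟩
  obtain ⟨j, hj, h⟩ := this
  exact ⟨j, hj, main j hj h⟩

lemma cov3 (m d : ℕ) (hm : m % 2 = 1) (hm4 : 3 ≤ m)
    (hd : 1 ≤ d) (hd' : d ≤ 4 * m + 2)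
    (h1 : ¬ (m = d ∨ 2 * m + 1 ≤ d ∧ d ≤ 4 * m)) : ∃ j, j < 2 * m + 1 ∧
    Diff (4 * (2 * m + 1) + 1) (XX3 m (R3 m j)) (XX3 m (R3 m (nxt (2 * m + 1) j))) d := by
  have main : ∀ j, j < 2 * m + 1 → (
      (j + 3 ≤ m ∧ j + d + 2 = 2 * m) ∨ (m ≤ j + 2 ∧ j + 5 ≤ 2 * m ∧ j + d + 4 = 2 * m) ∨
      (j + 4 = 2 * m ∧ d = 4 * m + 1) ∨ (j + 3 = 2 * m ∧ d + 1 = m) ∨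
      (j + 2 = 2 * m ∧ d + 1 = 2 * m) ∨ (j + 1 = 2 * m ∧ d = 2 * m) ∨
      (j = 2 * m ∧ d = 4 * m + 2)) →
      Diff (4 * (2 * m + 1) + 1) (XX3 m (R3 m j)) (XX3 m (R3 m (nxt (2 * m + 1) j))) d := by
    intro j hj h
    rw [xr3 m _ hm hm4 hj, xr3 m _ hm hm4 (nxt_lt hj)]
    unfold Diff nxt
    split_ifs <;> omega
  have : ∃ j, j < 2 * m + 1 ∧ (
      (j + 3 ≤ m ∧ j + d + 2 = 2 * m) ∨ (m ≤ j + 2 ∧ j + 5 ≤ 2 * m ∧ j + d + 4 = 2 * m) ∨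
      (j + 4 = 2 * m ∧ d = 4 * m + 1) ∨ (j + 3 = 2 * m ∧ d + 1 = m) ∨
      (j + 2 = 2 * m ∧ d + 1 = 2 * m) ∨ (j + 1 = 2 * m ∧ d = 2 * m) ∨
      (j = 2 * m ∧ d = 4 * m + 2)) := by
    by_cases a1 : d = 4 * m + 1
    · exact ⟨2 * m - 4, by omega, by omega⟩
    by_cases a2 : d + 1 = m
    · exact ⟨2 * m - 3, by omega, by omega⟩
    by_cases a3 : d = 4 * m + 2
    · exact ⟨2 * m, by omega, by omega⟩
    by_cases a4 : d + 1 = 2 * m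
    · exact ⟨2 * m - 2, by omega, by omega⟩
    by_cases a6 : d = 2 * m
    · exact ⟨2 * m - 1, by omega, by omega⟩
    by_cases a5 : d < m
    · exact ⟨2 * m - 4 - d, by omega, by omega⟩
    · exact ⟨2 * m - 2 - d, by omega, by omega⟩
  obtain ⟨j, hj, h⟩ := this
  exact ⟨j, hj, main j hj h⟩

theorem stmt3 (ℓ : ℕ) (hℓ : 7 ≤ ℓ) (hodd : Odd ℓ) :
    letI : NeZero ℓ := ⟨by omega⟩
    ∃ (ι : Type) (cyc : ι → ZMod ℓ → Fin (4 * ℓ + 1)) (colour : Fin (4 * ℓ + 1) → Bool),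
      IsCycleDecomp (⊤ : SimpleGraph (Fin (4 * ℓ + 1))) cyc ∧
      (∀ i, IsEquitable colour (cyc i)) ∧
      ((Finset.univ.filter fun x => colour x = true).card = 2 * ℓ ∨
        (Finset.univ.filter fun x => colour x = true).card = 2 * ℓ + 1) := by
  obtain ⟨m, rfl⟩ := hodd
  rcases Nat.mod_two_eq_zero_or_one m with hm | hm
  · refine key (2 * m + 1) (by omega) (by omega)
      (fun b => if b then R1 m else R2 m) (fun b => if b then XX1 m else XX2 m) ?_ ?_ ?_ ?_ ?_ ?_
    · rintro (_ | _) j hj <;> simp only [reduceIte, Bool.false_eq_true]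
      · unfold R2; split_ifs <;> omega
      · unfold R1; split_ifs <;> omega
    · rintro (_ | _) i j hi hj h <;> simp only [reduceIte, Bool.false_eq_true] at h
      · unfold R2 at h; split_ifs at h <;> omega
      · unfold R1 at h; split_ifs at h <;> omega
    · rintro (_ | _) r hr <;> simp only [reduceIte, Bool.false_eq_true]
      · unfold XX2; split_ifs <;> omega
      · unfold XX1; split_ifs <;> omega
    · rintro (_ | _) r hr <;> simp only [reduceIte, Bool.false_eq_true]
      · unfold XX2; split_ifs <;> omega
      · unfold XX1; split_ifs <;> omega
    · rintro (_ | _) r hr <;> simp only [reduceIte, Bool.false_eq_true]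
      · unfold XX2; split_ifs <;> omega
      · unfold XX1; split_ifs <;> omega
    · intro d h1 h2
      by_cases h : m = d ∨ 2 * m + 1 ≤ d ∧ d ≤ 4 * m
      · exact ⟨true, cov1 m d h⟩
      · exact ⟨false, cov2 m d hm (by omega) h1 (by omega) h⟩
  · refine key (2 * m + 1) (by omega) (by omega)
      (fun b => if b then R1 m else R3 m) (fun b => if b then XX1 m else XX3 m) ?_ ?_ ?_ ?_ ?_ ?_
    · rintro (_ | _) j hj <;> simp only [reduceIte, Bool.false_eq_true]
      · unfold R3; split_ifs <;> omega
      · unfold R1; split_ifs <;> omega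
    · rintro (_ | _) i j hi hj h <;> simp only [reduceIte, Bool.false_eq_true] at h
      · unfold R3 at h; split_ifs at h <;> omega
      · unfold R1 at h; split_ifs at h <;> omega
    · rintro (_ | _) r hr <;> simp only [reduceIte, Bool.false_eq_true]
      · unfold XX3; split_ifs <;> omega
      · unfold XX1; split_ifs <;> omega
    · rintro (_ | _) r hr <;> simp only [reduceIte, Bool.false_eq_true]
      · unfold XX3; split_ifs <;> omega
      · unfold XX1; split_ifs <;> omega
    · rintro (_ | _) r hr <;> simp only [reduceIte, Bool.false_eq_true]
      · unfold XX3; split_ifs <;> omega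
      · unfold XX1; split_ifs <;> omega
    · intro d h1 h2
      by_cases h : m = d ∨ 2 * m + 1 ≤ d ∧ d ≤ 4 * m
      · exact ⟨true, cov1 m d h⟩
      · exact ⟨false, cov3 m d hm (by omega) h1 (by omega) h⟩
end

section
/- Let ℓ ≥ 7 be an odd integer. There exist an integer m ∈ {(ℓ−5)/2, (ℓ−3)/2, (ℓ−1)/2, (ℓ+1)/2} and two ℓ-cycles C_0 and C_1 with vertices in Z_{2ℓ} × {0,1} such that: (i) among the edges of C_0 and C_1 together there are exactly 2ℓ−2 mixed edges, and their mixed differences are precisely the elements of {1, 2, …, 2ℓ−1} \ {ℓ}, each occurring exactly once; (ii) for each i ∈ {0,1}, the cycle C_i contains exactly one pure edge, and this edge is i-pure of difference ±m; (iii) for each i ∈ {0,1} and every t ∈ Z_{2ℓ}, the translate of C_i by t is equitably 2-coloured under the standard colouring. -/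
/-- Vertices: `a_i` is the pair `(a, i)` with `a : ZMod (2ℓ)` and `i : Bool`
(part `0` is `false`, part `1` is `true`). -/
abbrev Pt (ℓ : ℕ) := ZMod (2 * ℓ) × Bool

/-- The standard colouring (red = `true`): `a_0` is red iff `0 ≤ a ≤ ℓ-1`,
and `a_1` is red iff `ℓ ≤ a ≤ 2ℓ-1`. -/
def stdColour (ℓ : ℕ) (x : Pt ℓ) : Bool :=
  xor (decide (x.1.val < ℓ)) x.2

/-- The edge of the cycle `c` from its `j`-th to its `(j+1)`-st vertex is mixed
(its endpoints lie in different parts). -/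
abbrev mixedEdge {ℓ : ℕ} (c : ZMod ℓ → Pt ℓ) (j : ZMod ℓ) : Prop :=
  (c j).2 ≠ (c (j + 1)).2

/-- The mixed difference of the `j`-th edge of `c` (oriented from the part-`0`
endpoint `a_0` to the part-`1` endpoint `b_1`, giving `b - a`). -/
def mixedDiff {ℓ : ℕ} (c : ZMod ℓ → Pt ℓ) (j : ZMod ℓ) : ZMod (2 * ℓ) :=
  if (c j).2 = false then (c (j + 1)).1 - (c j).1 else (c j).1 - (c (j + 1)).1

/-- The `j`-th edge of `c` is `i`-pure: both endpoints lie in part `i`. -/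
abbrev pureEdge {ℓ : ℕ} (c : ZMod ℓ → Pt ℓ) (i : Bool) (j : ZMod ℓ) : Prop :=
  (c j).2 = i ∧ (c (j + 1)).2 = i

/-- A representative of the (±) pure difference of the `j`-th edge of `c`. -/
def pureDiff {ℓ : ℕ} (c : ZMod ℓ → Pt ℓ) (j : ZMod ℓ) : ZMod (2 * ℓ) :=
  (c (j + 1)).1 - (c j).1

/-- The cycTranslate of the cycle `c` by `t`: add `t` to every first coordinate. -/
def cycTranslate {ℓ : ℕ} (t : ZMod (2 * ℓ)) (c : ZMod ℓ → Pt ℓ) : ZMod ℓ → Pt ℓ :=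
  fun j => ((c j).1 + t, (c j).2)

def hInd (L x : ℤ) : ℤ := if x % (2 * L) < L then 1 else 0

theorem hInd_cases (L x : ℤ) : hInd L x = 0 ∨ hInd L x = 1 := by
  unfold hInd; split_ifs <;> simp

/-- crossing lemma -/
theorem hInd_cross (L v y : ℤ) (h1 : y ≤ v) (h2 : v + 1 < y + L)
    (hne : hInd L (v + 1) - hInd L v ≠ 0) :
    (v + 1) % L = 0 ∧ (hInd L (v + 1) - hInd L v = 1 - 2 * hInd L y) := by
  have hL : 0 < L := by omega
  have a0 := Int.emod_nonneg v (show (2 * L) ≠ 0 by omega)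
  have a1 := Int.emod_lt_of_pos v (show 0 < 2 * L by omega)
  have a2 := Int.mul_ediv_add_emod v (2 * L)
  have b0 := Int.emod_nonneg y (show (2 * L) ≠ 0 by omega)
  have b1 := Int.emod_lt_of_pos y (show 0 < 2 * L by omega)
  have b2 := Int.mul_ediv_add_emod y (2 * L)
  set q := v / (2 * L) with hq
  set p := y / (2 * L) with hp
  set a := v % (2 * L) with ha
  set b := y % (2 * L) with hb
  have key : (v + 1) % (2 * L) = if a + 1 = 2 * L then 0 else a + 1 := by
    split_ifs with h
    · have : v + 1 = 2 * L * (q + 1) := by linarith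
      rw [this]; simp
    · have : v + 1 = (a + 1) + 2 * L * q := by linarith
      rw [this, Int.add_mul_emod_self_left, Int.emod_eq_of_lt (by omega) (by omega)]
  have hpq : p = q ∨ p = q - 1 := by
    have e1 : p ≤ q := by
      by_contra hc
      have : q + 1 ≤ p := by omega
      nlinarith
    have e2 : q - 1 ≤ p := by
      by_contra hc
      have : p ≤ q - 2 := by omega
      nlinarith
    omega
  unfold hInd at *
  rw [key] at hne ⊢
  rw [← ha, ← hb] at *
  by_cases c1 : a + 1 = 2 * L
  · rw [if_pos c1] at hne ⊢
    refine ⟨?_, ?_⟩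
    · have : v + 1 = L * (2 * (q + 1)) := by linarith
      rw [this]; simp
    · rcases hpq with h | h
      · rw [h] at b2
        rw [if_pos hL, if_neg (by omega), if_neg (by omega)]; norm_num
      · rw [h] at b2
        have : 2 * L * (q - 1) = 2 * L * q - 2 * L := by ring
        rw [if_pos hL, if_neg (by omega), if_neg (by omega)]; norm_num
  · rw [if_neg c1] at hne ⊢
    have c2 : a + 1 = L := by
      by_contra hc
      apply hne
      split_ifs <;> omega
    refine ⟨?_, ?_⟩
    · have : v + 1 = L * (2 * q + 1) := by linarith
      rw [this]; simp
    · rw [if_neg (by omega), if_pos (by omega)]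
      rcases hpq with h | h
      · rw [h] at b2
        rw [if_pos (by omega)]; norm_num
      · rw [h] at b2
        have : 2 * L * (q - 1) = 2 * L * q - 2 * L := by ring
        omega

structure Good (k : ℕ) (P D : ℕ → ℤ) (σ : ℕ → ℕ) (j0 m : ℕ) : Prop where
  bd : ∀ j ≤ 2 * k, -(2 * k + 1 : ℤ) ≤ P j ∧ P j < 2 * k + 1
  inj : ∀ i j, i ≤ 2 * k → j ≤ 2 * k → i % 2 = j % 2 → P i = P j → i = j
  dB : ∀ j < 2 * k, 1 ≤ D j ∧ D j ≤ 2 * k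
  step : ∀ j < 2 * k, P (j + 1) = P j + D j ∨ P (j + 1) = P j - D j
  dInj : ∀ i j, i < 2 * k → j < 2 * k → D i = D j → i = j
  fin : P (2 * k) = P 0 + m ∨ P (2 * k) = P 0 - m
  j0le : j0 ≤ 2 * k
  j0even : j0 % 2 = 0
  sg : ∀ i ≤ 2 * k, i % 2 = 1 → σ i ≤ 2 * k ∧ σ i % 2 = 0 ∧ σ i ≠ j0 ∧
    (P (σ i) = P i ∨ (P (σ i) = P i + 1 ∧ P j0 ≤ P i ∧ P i + 1 < P j0 + (2 * k + 1)))
  sInj : ∀ i j, i ≤ 2 * k → j ≤ 2 * k → i % 2 = 1 → j % 2 = 1 → σ i = σ j → i = j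

theorem card_odds (k : ℕ) : ((Finset.range (2 * k + 1)).filter (fun i => i % 2 = 1)).card = k := by
  induction k with
  | zero => decide
  | succ n ih =>
    rw [show 2 * (n + 1) + 1 = 2 * n + 1 + 1 + 1 by ring, Finset.range_add_one,
      Finset.range_add_one, Finset.filter_insert, Finset.filter_insert,
      if_neg (by omega), if_pos (by omega), Finset.card_insert_of_notMem (by simp), ih]

theorem card_evens (k : ℕ) :
    ((Finset.range (2 * k + 1)).filter (fun i => ¬ i % 2 = 1)).card = k + 1 := by
  have h := Finset.card_filter_add_card_filter_not (s := Finset.range (2 * k + 1))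
    (fun i => i % 2 = 1)
  rw [card_odds, Finset.card_range] at h
  omega

theorem Good.sum {k : ℕ} {P D : ℕ → ℤ} {σ : ℕ → ℕ} {j0 m : ℕ} (g : Good k P D σ j0 m) (T : ℤ) :
    let S := ∑ v ∈ Finset.range (2 * k + 1),
      (if v % 2 = 1 then 1 - hInd (2 * k + 1) (P v + T) else hInd (2 * k + 1) (P v + T))
    S = k ∨ S = k + 1 := by
  intro S
  set H : ℕ → ℤ := fun v => hInd (2 * k + 1) (P v + T) with hH
  set O := (Finset.range (2 * k + 1)).filter (fun i => i % 2 = 1) with hO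
  set Ev := (Finset.range (2 * k + 1)).filter (fun i => ¬ i % 2 = 1) with hEv
  have hS : S = ∑ v ∈ O, (1 - H v) + ∑ v ∈ Ev, H v := by
    simp only [S]
    rw [Finset.sum_ite]
  have himg : O.image σ = Ev.erase j0 := by
    apply Finset.eq_of_subset_of_card_le
    · intro x hx
      rw [Finset.mem_image] at hx
      obtain ⟨i, hi, rfl⟩ := hx
      simp only [hO, Finset.mem_filter, Finset.mem_range] at hi
      have := g.sg i (by omega) hi.2
      simp only [hEv, Finset.mem_erase, Finset.mem_filter, Finset.mem_range]
      omega
    · rw [Finset.card_image_of_injOn, Finset.card_erase_of_mem, card_odds, card_evens]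
      · omega
      · simp only [hEv, Finset.mem_filter, Finset.mem_range]
        have := g.j0le; have := g.j0even; omega
      · intro i hi j hj hij
        simp only [hO, Finset.coe_filter, Finset.mem_range, Set.mem_ofPred_eq] at hi hj
        exact g.sInj i j (by omega) (by omega) hi.2 hj.2 hij
  have hE : ∑ v ∈ Ev, H v = H j0 + ∑ i ∈ O, H (σ i) := by
    rw [← Finset.add_sum_erase Ev H (a := j0), ← himg, Finset.sum_image]
    · intro i hi j hj hij
      simp only [hO, Finset.coe_filter, Finset.mem_range, Set.mem_ofPred_eq] at hi hj
      exact g.sInj i j (by omega) (by omega) hi.2 hj.2 hij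
    · simp only [hEv, Finset.mem_filter, Finset.mem_range]
      have := g.j0le; have := g.j0even; omega
  have hS2 : S = k + H j0 + ∑ i ∈ O, (H (σ i) - H i) := by
    rw [hS, hE, Finset.sum_sub_distrib, Finset.sum_sub_distrib, Finset.sum_const, card_odds]
    simp; ring
  have h01 := hInd_cases (2 * k + 1) (P j0 + T)
  have hcross : ∀ i ∈ O, H (σ i) - H i ≠ 0 →
      P j0 ≤ P i ∧ P i + 1 < P j0 + (2 * k + 1) ∧
      (P i + T + 1) % (2 * k + 1) = 0 ∧ H (σ i) - H i = 1 - 2 * H j0 := by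
    intro i hi hne
    simp only [hO, Finset.mem_filter, Finset.mem_range] at hi
    obtain ⟨-, -, -, h | ⟨h, h1, h2⟩⟩ := g.sg i (by omega) hi.2
    · exact absurd (by simp [hH, h]) hne
    · have e : P (σ i) + T = P i + T + 1 := by omega
      simp only [hH, e] at hne ⊢
      have := hInd_cross (2 * k + 1) (P i + T) (P j0 + T) (by omega) (by omega) hne
      exact ⟨h1, h2, this⟩
  by_cases hall : ∀ i ∈ O, H (σ i) - H i = 0
  · rw [hS2, Finset.sum_eq_zero hall]
    change H j0 = 0 ∨ H j0 = 1 at h01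
    omega
  · push Not at hall
    obtain ⟨i, hi, hne⟩ := hall
    obtain ⟨a1, a2, a3, a4⟩ := hcross i hi hne
    rw [hS2, Finset.sum_eq_single_of_mem i hi, a4]
    · change H j0 = 0 ∨ H j0 = 1 at h01
      omega
    · intro j hj hji
      by_contra hc
      obtain ⟨b1, b2, b3, b4⟩ := hcross j hj hc
      apply hji
      simp only [hO, Finset.mem_filter, Finset.mem_range] at hi hj
      apply g.inj j i (by omega) (by omega) (by omega)
      have hd : ((2 * k + 1 : ℤ)) ∣ P j - P i := by
        have := dvd_sub (Int.dvd_of_emod_eq_zero b3) (Int.dvd_of_emod_eq_zero a3)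
        have e : P j - P i = P j + T + 1 - (P i + T + 1) := by ring
        rw [e]; exact this
      have := Int.eq_zero_of_abs_lt_dvd hd (by rw [abs_lt]; constructor <;> omega)
      omega


def PA (r j : ℕ) : ℤ :=
  if j ≤ 4 * r ∧ j % 2 = 0 then -(j : ℤ) else
  if j ≤ 4 * r ∧ j % 2 = 1 then (j : ℤ) else
  if 4 * r < j ∧ j % 2 = 0 then (j : ℤ) - 4 * r else
  if 4 * r < j ∧ j % 2 = 1 ∧ j < 6 * r + 1 then 4 * r + 1 - (j : ℤ) else
  4 * r - 1 - (j : ℤ)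

theorem PA_spec (r j : ℕ) (hr : 1 ≤ r) (hj : j ≤ 2 * (4 * r)) :
    (j ≤ 4 * r ∧ j % 2 = 0 ∧ PA r j = -(j : ℤ)) ∨
    (j ≤ 4 * r ∧ j % 2 = 1 ∧ PA r j = (j : ℤ)) ∨
    (4 * r < j ∧ j % 2 = 0 ∧ PA r j = (j : ℤ) - 4 * r) ∨
    (4 * r < j ∧ j % 2 = 1 ∧ j < 6 * r + 1 ∧ PA r j = 4 * r + 1 - (j : ℤ)) ∨
    (j % 2 = 1 ∧ 6 * r + 1 ≤ j ∧ PA r j = 4 * r - 1 - (j : ℤ)) := by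
  unfold PA; split_ifs
  · exact Or.inl ⟨by omega, by omega, rfl⟩
  · exact Or.inr <| Or.inl ⟨by omega, by omega, rfl⟩
  · exact Or.inr <| Or.inr <| Or.inl ⟨by omega, by omega, rfl⟩
  · exact Or.inr <| Or.inr <| Or.inr <| Or.inl ⟨by omega, by omega, by omega, rfl⟩
  · exact Or.inr <| Or.inr <| Or.inr <| Or.inr <| ⟨by omega, by omega, rfl⟩

def DA (r j : ℕ) : ℤ :=
  if j < 4 * r then 2 * (j : ℤ) + 1 else
  if j = 4 * r then 4 * r else
  if 4 * r < j ∧ j < 6 * r then 2 * ((j : ℤ) - 4 * r) else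
  2 * ((j : ℤ) - 4 * r + 1)

theorem DA_spec (r j : ℕ) (hr : 1 ≤ r) (hj : j < 2 * (4 * r)) :
    (j < 4 * r ∧ DA r j = 2 * (j : ℤ) + 1) ∨
    (j = 4 * r ∧ DA r j = 4 * r) ∨
    (4 * r < j ∧ j < 6 * r ∧ DA r j = 2 * ((j : ℤ) - 4 * r)) ∨
    (4 * r < j ∧ 6 * r ≤ j ∧ DA r j = 2 * ((j : ℤ) - 4 * r + 1)) := by
  unfold DA; split_ifs
  · exact Or.inl ⟨by omega, rfl⟩
  · exact Or.inr <| Or.inl ⟨by omega, rfl⟩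
  · exact Or.inr <| Or.inr <| Or.inl ⟨by omega, by omega, rfl⟩
  · exact Or.inr <| Or.inr <| Or.inr <| ⟨by omega, by omega, rfl⟩

def sA (r j : ℕ) : ℕ :=
  if j < 4 * r then 4 * r + j + 1 else
  if 4 * r ≤ j ∧ j < 6 * r + 1 then j - 4 * r - 1 else
  j - 4 * r + 1

theorem sA_spec (r j : ℕ) (hr : 1 ≤ r) (hj : j ≤ 2 * (4 * r)) (hp : j % 2 = 1) :
    (j < 4 * r ∧ sA r j = 4 * r + j + 1) ∨
    (4 * r ≤ j ∧ j < 6 * r + 1 ∧ sA r j = j - 4 * r - 1) ∨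
    (6 * r + 1 ≤ j ∧ sA r j = j - 4 * r + 1) := by
  unfold sA; split_ifs
  · exact Or.inl ⟨by omega, rfl⟩
  · exact Or.inr <| Or.inl ⟨by omega, by omega, rfl⟩
  · exact Or.inr <| Or.inr <| ⟨by omega, rfl⟩

set_option maxHeartbeats 4000000 in
theorem goodA (r : ℕ) (hr : 1 ≤ r) :
    Good (4 * r) (PA r) (DA r) (sA r) (2 * r) (4 * r) := by
  constructor
  · intro j hj
    rcases PA_spec r j hr hj with h | h | h | h | h <;> omega
  · intro i j hi hj hp e
    rcases PA_spec r i hr hi with h | h | h | h | h <;>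
    rcases PA_spec r j hr hj with g | g | g | g | g <;> omega
  · intro j hj
    rcases DA_spec r j hr hj with h | h | h | h <;> omega
  · intro j hj
    rcases DA_spec r j hr hj with h | h | h | h <;>
    rcases PA_spec r j hr (by omega) with g | g | g | g | g <;> first | omega |
    (rcases PA_spec r (j + 1) hr (by omega) with w | w | w | w | w <;> omega)
  · intro i j hi hj e
    rcases DA_spec r i hr hi with h | h | h | h <;>
    rcases DA_spec r j hr hj with g | g | g | g <;> omega
  · rcases PA_spec r (2 * (4 * r)) hr (by omega) with h | h | h | h | h <;>
    rcases PA_spec r 0 hr (by omega) with g | g | g | g | g <;> omega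
  · omega
  · omega
  · intro i hi hp
    have a1 : sA r i ≤ 2 * (4 * r) ∧ sA r i % 2 = 0 ∧ sA r i ≠ 2 * r := by
      rcases sA_spec r i hr hi hp with h | h | h <;> omega
    refine ⟨a1.1, a1.2.1, a1.2.2, ?_⟩
    have b := PA_spec r (sA r i) hr a1.1
    have c : PA r (2 * r) = -(2 * r : ℤ) := by
      rcases PA_spec r (2 * r) hr (by omega) with h | h | h | h | h <;> omega
    rcases sA_spec r i hr hi hp with h | h | h <;>
    rcases PA_spec r i hr hi with g | g | g | g | g <;> first | omega |
    (rcases b with w | w | w | w | w <;> omega)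
  · intro i j hi hj hp hq e
    rcases sA_spec r i hr hi hp with h | h | h <;>
    rcases sA_spec r j hr hj hq with g | g | g <;> omega

def PB (r j : ℕ) : ℤ :=
  if j ≤ 4 * r + 1 ∧ j % 2 = 0 then (j : ℤ) else
  if j ≤ 4 * r + 1 ∧ j % 2 = 1 then 8 * r + 4 - (j : ℤ) else
  if j = 8 * r + 4 then 4 * r + 2 else
  if 4 * r + 1 < j ∧ j ≠ 8 * r + 4 ∧ j % 2 = 0 then (j : ℤ) + 2 else
  if 4 * r + 1 < j ∧ j % 2 = 1 ∧ j < 6 * r + 2 then 8 * r + 5 - (j : ℤ) else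
  8 * r + 3 - (j : ℤ)

theorem PB_spec (r j : ℕ) (hr : 1 ≤ r) (hj : j ≤ 2 * (4 * r + 2)) :
    (j ≤ 4 * r + 1 ∧ j % 2 = 0 ∧ PB r j = (j : ℤ)) ∨
    (j ≤ 4 * r + 1 ∧ j % 2 = 1 ∧ PB r j = 8 * r + 4 - (j : ℤ)) ∨
    (j = 8 * r + 4 ∧ PB r j = 4 * r + 2) ∨
    (4 * r + 1 < j ∧ j ≠ 8 * r + 4 ∧ j % 2 = 0 ∧ PB r j = (j : ℤ) + 2) ∨
    (4 * r + 1 < j ∧ j % 2 = 1 ∧ j < 6 * r + 2 ∧ PB r j = 8 * r + 5 - (j : ℤ)) ∨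
    (4 * r + 1 < j ∧ j % 2 = 1 ∧ 6 * r + 2 ≤ j ∧ PB r j = 8 * r + 3 - (j : ℤ)) := by
  unfold PB; split_ifs
  · exact Or.inl ⟨by omega, by omega, rfl⟩
  · exact Or.inr <| Or.inl ⟨by omega, by omega, rfl⟩
  · exact Or.inr <| Or.inr <| Or.inl ⟨by omega, rfl⟩
  · exact Or.inr <| Or.inr <| Or.inr <| Or.inl ⟨by omega, by omega, by omega, rfl⟩
  · exact Or.inr <| Or.inr <| Or.inr <| Or.inr <| Or.inl ⟨by omega, by omega, by omega, rfl⟩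
  · exact Or.inr <| Or.inr <| Or.inr <| Or.inr <| Or.inr <| ⟨by omega, by omega, by omega, rfl⟩

def DB (r j : ℕ) : ℤ :=
  if j ≤ 4 * r + 1 then 8 * r + 3 - 2 * (j : ℤ) else
  if j = 8 * r + 3 then 4 * r + 2 else
  if 4 * r + 1 < j ∧ j < 6 * r + 2 then 2 * ((j : ℤ) - 4 * r - 1) else
  2 * ((j : ℤ) - 4 * r)

theorem DB_spec (r j : ℕ) (hr : 1 ≤ r) (hj : j < 2 * (4 * r + 2)) :
    (j ≤ 4 * r + 1 ∧ DB r j = 8 * r + 3 - 2 * (j : ℤ)) ∨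
    (j = 8 * r + 3 ∧ DB r j = 4 * r + 2) ∨
    (4 * r + 1 < j ∧ j < 6 * r + 2 ∧ DB r j = 2 * ((j : ℤ) - 4 * r - 1)) ∨
    (4 * r + 1 < j ∧ j ≠ 8 * r + 3 ∧ 6 * r + 2 ≤ j ∧ DB r j = 2 * ((j : ℤ) - 4 * r)) := by
  unfold DB; split_ifs
  · exact Or.inl ⟨by omega, rfl⟩
  · exact Or.inr <| Or.inl ⟨by omega, rfl⟩
  · exact Or.inr <| Or.inr <| Or.inl ⟨by omega, by omega, rfl⟩
  · exact Or.inr <| Or.inr <| Or.inr <| ⟨by omega, by omega, by omega, rfl⟩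

def sB (r j : ℕ) : ℕ :=
  if j ≤ 4 * r + 1 then 8 * r + 3 - j else
  if j = 4 * r + 3 then 8 * r + 4 else
  if 4 * r + 5 ≤ j ∧ j < 6 * r + 2 then 8 * r + 5 - j else
  8 * r + 3 - j

theorem sB_spec (r j : ℕ) (hr : 1 ≤ r) (hj : j ≤ 2 * (4 * r + 2)) (hp : j % 2 = 1) :
    (j ≤ 4 * r + 1 ∧ sB r j = 8 * r + 3 - j) ∨
    (j = 4 * r + 3 ∧ sB r j = 8 * r + 4) ∨
    (4 * r + 5 ≤ j ∧ j < 6 * r + 2 ∧ sB r j = 8 * r + 5 - j) ∨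
    (4 * r + 5 ≤ j ∧ 6 * r + 2 ≤ j ∧ sB r j = 8 * r + 3 - j) := by
  unfold sB; split_ifs
  · exact Or.inl ⟨by omega, rfl⟩
  · exact Or.inr <| Or.inl ⟨by omega, rfl⟩
  · exact Or.inr <| Or.inr <| Or.inl ⟨by omega, by omega, rfl⟩
  · exact Or.inr <| Or.inr <| Or.inr <| ⟨by omega, by omega, rfl⟩

set_option maxHeartbeats 4000000 in
theorem goodB (r : ℕ) (hr : 1 ≤ r) :
    Good (4 * r + 2) (PB r) (DB r) (sB r) (2 * r + 2) (4 * r + 2) := by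
  constructor
  · intro j hj
    rcases PB_spec r j hr hj with h | h | h | h | h | h <;> omega
  · intro i j hi hj hp e
    rcases PB_spec r i hr hi with h | h | h | h | h | h <;>
    rcases PB_spec r j hr hj with g | g | g | g | g | g <;> omega
  · intro j hj
    rcases DB_spec r j hr hj with h | h | h | h <;> omega
  · intro j hj
    rcases DB_spec r j hr hj with h | h | h | h <;>
    rcases PB_spec r j hr (by omega) with g | g | g | g | g | g <;> first | omega |
    (rcases PB_spec r (j + 1) hr (by omega) with w | w | w | w | w | w <;> omega)
  · intro i j hi hj e
    rcases DB_spec r i hr hi with h | h | h | h <;>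
    rcases DB_spec r j hr hj with g | g | g | g <;> omega
  · rcases PB_spec r (2 * (4 * r + 2)) hr (by omega) with h | h | h | h | h | h <;>
    rcases PB_spec r 0 hr (by omega) with g | g | g | g | g | g <;> omega
  · omega
  · omega
  · intro i hi hp
    have a1 : sB r i ≤ 2 * (4 * r + 2) ∧ sB r i % 2 = 0 ∧ sB r i ≠ 2 * r + 2 := by
      rcases sB_spec r i hr hi hp with h | h | h | h <;> omega
    refine ⟨a1.1, a1.2.1, a1.2.2, ?_⟩
    have b := PB_spec r (sB r i) hr a1.1
    have c : PB r (2 * r + 2) = 2 * r + 2 := by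
      rcases PB_spec r (2 * r + 2) hr (by omega) with h | h | h | h | h | h <;> omega
    rcases sB_spec r i hr hi hp with h | h | h | h <;>
    rcases PB_spec r i hr hi with g | g | g | g | g | g <;> first | omega |
    (rcases b with w | w | w | w | w | w <;> omega)
  · intro i j hi hj hp hq e
    rcases sB_spec r i hr hi hp with h | h | h | h <;>
    rcases sB_spec r j hr hj hq with g | g | g | g <;> omega

def PC (r j : ℕ) : ℤ :=
  if j ≤ 4 * r + 3 ∧ j % 2 = 0 then -(j : ℤ) else
  if j ≤ 4 * r + 3 ∧ j % 2 = 1 then (j : ℤ) + 1 else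
  if j = 4 * r + 4 then 4 * r + 5 else
  if 4 * r + 4 < j ∧ j % 2 = 0 then (j : ℤ) - 4 * r - 3 else
  if 4 * r + 4 < j ∧ j % 2 = 1 ∧ j ≤ 6 * r + 6 then 4 * r + 5 - (j : ℤ) else
  4 * r + 3 - (j : ℤ)

theorem PC_spec (r j : ℕ) (hr : 1 ≤ r) (hj : j ≤ 2 * (4 * r + 3)) :
    (j ≤ 4 * r + 3 ∧ j % 2 = 0 ∧ PC r j = -(j : ℤ)) ∨
    (j ≤ 4 * r + 3 ∧ j % 2 = 1 ∧ PC r j = (j : ℤ) + 1) ∨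
    (j = 4 * r + 4 ∧ PC r j = 4 * r + 5) ∨
    (4 * r + 4 < j ∧ j % 2 = 0 ∧ PC r j = (j : ℤ) - 4 * r - 3) ∨
    (4 * r + 4 < j ∧ j % 2 = 1 ∧ j ≤ 6 * r + 6 ∧ PC r j = 4 * r + 5 - (j : ℤ)) ∨
    (j % 2 = 1 ∧ 6 * r + 6 < j ∧ PC r j = 4 * r + 3 - (j : ℤ)) := by
  unfold PC; split_ifs
  · exact Or.inl ⟨by omega, by omega, rfl⟩
  · exact Or.inr <| Or.inl ⟨by omega, by omega, rfl⟩
  · exact Or.inr <| Or.inr <| Or.inl ⟨by omega, rfl⟩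
  · exact Or.inr <| Or.inr <| Or.inr <| Or.inl ⟨by omega, by omega, rfl⟩
  · exact Or.inr <| Or.inr <| Or.inr <| Or.inr <| Or.inl ⟨by omega, by omega, by omega, rfl⟩
  · exact Or.inr <| Or.inr <| Or.inr <| Or.inr <| Or.inr <| ⟨by omega, by omega, rfl⟩

def DC (r j : ℕ) : ℤ :=
  if j ≤ 4 * r + 2 then 2 * (j : ℤ) + 2 else
  if j = 4 * r + 3 then 1 else
  if j = 4 * r + 4 then 4 * r + 5 else
  if 4 * r + 4 < j ∧ j < 6 * r + 6 then 2 * ((j : ℤ) - 4 * r - 5) + 3 else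
  2 * ((j : ℤ) - 4 * r - 5) + 5

theorem DC_spec (r j : ℕ) (hr : 1 ≤ r) (hj : j < 2 * (4 * r + 3)) :
    (j ≤ 4 * r + 2 ∧ DC r j = 2 * (j : ℤ) + 2) ∨
    (j = 4 * r + 3 ∧ DC r j = 1) ∨
    (j = 4 * r + 4 ∧ DC r j = 4 * r + 5) ∨
    (4 * r + 4 < j ∧ j < 6 * r + 6 ∧ DC r j = 2 * ((j : ℤ) - 4 * r - 5) + 3) ∨
    (4 * r + 4 < j ∧ 6 * r + 6 ≤ j ∧ DC r j = 2 * ((j : ℤ) - 4 * r - 5) + 5) := by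
  unfold DC; split_ifs
  · exact Or.inl ⟨by omega, rfl⟩
  · exact Or.inr <| Or.inl ⟨by omega, rfl⟩
  · exact Or.inr <| Or.inr <| Or.inl ⟨by omega, rfl⟩
  · exact Or.inr <| Or.inr <| Or.inr <| Or.inl ⟨by omega, by omega, rfl⟩
  · exact Or.inr <| Or.inr <| Or.inr <| Or.inr <| ⟨by omega, by omega, rfl⟩

def sC (r j : ℕ) : ℕ :=
  if j < 4 * r + 3 then j + 4 * r + 5 else
  if j = 4 * r + 3 then 4 * r + 4 else
  if 4 * r + 3 < j ∧ j ≤ 6 * r + 6 then j - 4 * r - 5 else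
  j - 4 * r - 3

theorem sC_spec (r j : ℕ) (hr : 1 ≤ r) (hj : j ≤ 2 * (4 * r + 3)) (hp : j % 2 = 1) :
    (j < 4 * r + 3 ∧ sC r j = j + 4 * r + 5) ∨
    (j = 4 * r + 3 ∧ sC r j = 4 * r + 4) ∨
    (4 * r + 3 < j ∧ j ≤ 6 * r + 6 ∧ sC r j = j - 4 * r - 5) ∨
    (4 * r + 3 < j ∧ 6 * r + 6 < j ∧ sC r j = j - 4 * r - 3) := by
  unfold sC; split_ifs
  · exact Or.inl ⟨by omega, rfl⟩
  · exact Or.inr <| Or.inl ⟨by omega, rfl⟩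
  · exact Or.inr <| Or.inr <| Or.inl ⟨by omega, by omega, rfl⟩
  · exact Or.inr <| Or.inr <| Or.inr <| ⟨by omega, by omega, rfl⟩

set_option maxHeartbeats 4000000 in
theorem goodC (r : ℕ) (hr : 1 ≤ r) :
    Good (4 * r + 3) (PC r) (DC r) (sC r) (2 * r + 2) (4 * r + 3) := by
  constructor
  · intro j hj
    rcases PC_spec r j hr hj with h | h | h | h | h | h <;> omega
  · intro i j hi hj hp e
    rcases PC_spec r i hr hi with h | h | h | h | h | h <;>
    rcases PC_spec r j hr hj with g | g | g | g | g | g <;> omega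
  · intro j hj
    rcases DC_spec r j hr hj with h | h | h | h | h <;> omega
  · intro j hj
    rcases DC_spec r j hr hj with h | h | h | h | h <;>
    rcases PC_spec r j hr (by omega) with g | g | g | g | g | g <;> first | omega |
    (rcases PC_spec r (j + 1) hr (by omega) with w | w | w | w | w | w <;> omega)
  · intro i j hi hj e
    rcases DC_spec r i hr hi with h | h | h | h | h <;>
    rcases DC_spec r j hr hj with g | g | g | g | g <;> omega
  · rcases PC_spec r (2 * (4 * r + 3)) hr (by omega) with h | h | h | h | h | h <;>
    rcases PC_spec r 0 hr (by omega) with g | g | g | g | g | g <;> omega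
  · omega
  · omega
  · intro i hi hp
    have a1 : sC r i ≤ 2 * (4 * r + 3) ∧ sC r i % 2 = 0 ∧ sC r i ≠ 2 * r + 2 := by
      rcases sC_spec r i hr hi hp with h | h | h | h <;> omega
    refine ⟨a1.1, a1.2.1, a1.2.2, ?_⟩
    have b := PC_spec r (sC r i) hr a1.1
    have c : PC r (2 * r + 2) = -(2 * r + 2 : ℤ) := by
      rcases PC_spec r (2 * r + 2) hr (by omega) with h | h | h | h | h | h <;> omega
    rcases sC_spec r i hr hi hp with h | h | h | h <;>
    rcases PC_spec r i hr hi with g | g | g | g | g | g <;> first | omega |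
    (rcases b with w | w | w | w | w | w <;> omega)
  · intro i j hi hj hp hq e
    rcases sC_spec r i hr hi hp with h | h | h | h <;>
    rcases sC_spec r j hr hj hq with g | g | g | g <;> omega

def PE (r j : ℕ) : ℤ :=
  if j = 0 then 0 else
  if j = 2 then 4 * r + 3 else
  if j ≤ 4 * r + 2 ∧ j % 2 = 1 then 4 * r + 3 - (j : ℤ) else
  if 4 ≤ j ∧ j ≤ 4 * r + 2 ∧ j % 2 = 0 then (j : ℤ) - 4 * r - 5 else
  if 4 * r + 2 < j ∧ j % 2 = 0 then (j : ℤ) - 4 * r - 1 else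
  if 4 * r + 2 < j ∧ j % 2 = 1 ∧ j < 6 * r + 3 then 4 * r + 2 - (j : ℤ) else
  4 * r - (j : ℤ)

theorem PE_spec (r j : ℕ) (hr : 1 ≤ r) (hj : j ≤ 2 * (4 * r + 1)) :
    (j = 0 ∧ PE r j = 0) ∨
    (j = 2 ∧ PE r j = 4 * r + 3) ∨
    (j ≤ 4 * r + 2 ∧ j % 2 = 1 ∧ PE r j = 4 * r + 3 - (j : ℤ)) ∨
    (4 ≤ j ∧ j ≤ 4 * r + 2 ∧ j % 2 = 0 ∧ PE r j = (j : ℤ) - 4 * r - 5) ∨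
    (4 * r + 2 < j ∧ j % 2 = 0 ∧ PE r j = (j : ℤ) - 4 * r - 1) ∨
    (4 * r + 2 < j ∧ j % 2 = 1 ∧ j < 6 * r + 3 ∧ PE r j = 4 * r + 2 - (j : ℤ)) ∨
    (4 * r + 2 < j ∧ j % 2 = 1 ∧ 6 * r + 3 ≤ j ∧ PE r j = 4 * r - (j : ℤ)) := by
  unfold PE; split_ifs
  · exact Or.inl ⟨by omega, rfl⟩
  · exact Or.inr <| Or.inl ⟨by omega, rfl⟩
  · exact Or.inr <| Or.inr <| Or.inl ⟨by omega, by omega, rfl⟩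
  · exact Or.inr <| Or.inr <| Or.inr <| Or.inl ⟨by omega, by omega, by omega, rfl⟩
  · exact Or.inr <| Or.inr <| Or.inr <| Or.inr <| Or.inl ⟨by omega, by omega, rfl⟩
  · exact Or.inr <| Or.inr <| Or.inr <| Or.inr <| Or.inr <| Or.inl ⟨by omega, by omega, by omega, rfl⟩
  · exact Or.inr <| Or.inr <| Or.inr <| Or.inr <| Or.inr <| Or.inr <| ⟨by omega, by omega, by omega, rfl⟩

def DE (r j : ℕ) : ℤ :=
  if j = 0 then 4 * r + 2 else
  if j = 1 then 1 else
  if j = 2 then 3 else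
  if 3 ≤ j ∧ j ≤ 4 * r + 1 then 8 * r + 7 - 2 * (j : ℤ) else
  if j = 4 * r + 2 then 2 else
  if 4 * r + 2 < j ∧ j < 6 * r + 2 then 2 * ((j : ℤ) - 4 * r - 3) + 4 else
  2 * ((j : ℤ) - 4 * r - 3) + 6

theorem DE_spec (r j : ℕ) (hr : 1 ≤ r) (hj : j < 2 * (4 * r + 1)) :
    (j = 0 ∧ DE r j = 4 * r + 2) ∨
    (j = 1 ∧ DE r j = 1) ∨
    (j = 2 ∧ DE r j = 3) ∨
    (3 ≤ j ∧ j ≤ 4 * r + 1 ∧ DE r j = 8 * r + 7 - 2 * (j : ℤ)) ∨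
    (j = 4 * r + 2 ∧ DE r j = 2) ∨
    (4 * r + 2 < j ∧ j < 6 * r + 2 ∧ DE r j = 2 * ((j : ℤ) - 4 * r - 3) + 4) ∨
    (4 * r + 2 < j ∧ 6 * r + 2 ≤ j ∧ DE r j = 2 * ((j : ℤ) - 4 * r - 3) + 6) := by
  unfold DE; split_ifs
  · exact Or.inl ⟨by omega, rfl⟩
  · exact Or.inr <| Or.inl ⟨by omega, rfl⟩
  · exact Or.inr <| Or.inr <| Or.inl ⟨by omega, rfl⟩
  · exact Or.inr <| Or.inr <| Or.inr <| Or.inl ⟨by omega, by omega, rfl⟩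
  · exact Or.inr <| Or.inr <| Or.inr <| Or.inr <| Or.inl ⟨by omega, rfl⟩
  · exact Or.inr <| Or.inr <| Or.inr <| Or.inr <| Or.inr <| Or.inl ⟨by omega, by omega, rfl⟩
  · exact Or.inr <| Or.inr <| Or.inr <| Or.inr <| Or.inr <| Or.inr <| ⟨by omega, by omega, rfl⟩

def sE (r j : ℕ) : ℕ :=
  if j = 1 then 2 else
  if j ≠ 1 ∧ j ≤ 4 * r + 1 then 8 * r + 5 - j else
  if j = 4 * r + 3 then 0 else
  if 4 * r + 3 < j ∧ j < 6 * r + 3 then 8 * r + 7 - j else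
  8 * r + 5 - j

theorem sE_spec (r j : ℕ) (hr : 1 ≤ r) (hj : j ≤ 2 * (4 * r + 1)) (hp : j % 2 = 1) :
    (j = 1 ∧ sE r j = 2) ∨
    (j ≠ 1 ∧ j ≤ 4 * r + 1 ∧ sE r j = 8 * r + 5 - j) ∨
    (j = 4 * r + 3 ∧ sE r j = 0) ∨
    (4 * r + 3 < j ∧ j < 6 * r + 3 ∧ sE r j = 8 * r + 7 - j) ∨
    (4 * r + 3 < j ∧ 6 * r + 3 ≤ j ∧ sE r j = 8 * r + 5 - j) := by
  unfold sE; split_ifs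
  · exact Or.inl ⟨by omega, rfl⟩
  · exact Or.inr <| Or.inl ⟨by omega, by omega, rfl⟩
  · exact Or.inr <| Or.inr <| Or.inl ⟨by omega, rfl⟩
  · exact Or.inr <| Or.inr <| Or.inr <| Or.inl ⟨by omega, by omega, rfl⟩
  · exact Or.inr <| Or.inr <| Or.inr <| Or.inr <| ⟨by omega, by omega, rfl⟩

set_option maxHeartbeats 4000000 in
theorem goodE (r : ℕ) (hr : 1 ≤ r) :
    Good (4 * r + 1) (PE r) (DE r) (sE r) (2 * r + 4) (4 * r + 1) := by
  constructor
  · intro j hj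
    rcases PE_spec r j hr hj with h | h | h | h | h | h | h <;> omega
  · intro i j hi hj hp e
    rcases PE_spec r i hr hi with h | h | h | h | h | h | h <;>
    rcases PE_spec r j hr hj with g | g | g | g | g | g | g <;> omega
  · intro j hj
    rcases DE_spec r j hr hj with h | h | h | h | h | h | h <;> omega
  · intro j hj
    rcases DE_spec r j hr hj with h | h | h | h | h | h | h <;>
    rcases PE_spec r j hr (by omega) with g | g | g | g | g | g | g <;> first | omega |
    (rcases PE_spec r (j + 1) hr (by omega) with w | w | w | w | w | w | w <;> omega)
  · intro i j hi hj e
    rcases DE_spec r i hr hi with h | h | h | h | h | h | h <;>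
    rcases DE_spec r j hr hj with g | g | g | g | g | g | g <;> omega
  · rcases PE_spec r (2 * (4 * r + 1)) hr (by omega) with h | h | h | h | h | h | h <;>
    rcases PE_spec r 0 hr (by omega) with g | g | g | g | g | g | g <;> omega
  · omega
  · omega
  · intro i hi hp
    have a1 : sE r i ≤ 2 * (4 * r + 1) ∧ sE r i % 2 = 0 ∧ sE r i ≠ 2 * r + 4 := by
      rcases sE_spec r i hr hi hp with h | h | h | h | h <;> omega
    refine ⟨a1.1, a1.2.1, a1.2.2, ?_⟩
    have b := PE_spec r (sE r i) hr a1.1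
    have c : PE r (2 * r + 4) = -(2 * r + 1 : ℤ) := by
      rcases PE_spec r (2 * r + 4) hr (by omega) with h | h | h | h | h | h | h <;> omega
    rcases sE_spec r i hr hi hp with h | h | h | h | h <;>
    rcases PE_spec r i hr hi with g | g | g | g | g | g | g <;> first | omega |
    (rcases b with w | w | w | w | w | w | w <;> omega)
  · intro i j hi hj hp hq e
    rcases sE_spec r i hr hi hp with h | h | h | h | h <;>
    rcases sE_spec r j hr hj hq with g | g | g | g | g <;> omega

def PF (j : ℕ) : ℤ :=
  if j = 0 then 0 else if j = 1 then 1 else if j = 2 then -3 else if j = 3 then 0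
  else if j = 4 then -6 else if j = 5 then -4 else 1

def DF (j : ℕ) : ℤ :=
  if j = 0 then 1 else if j = 1 then 4 else if j = 2 then 3 else if j = 3 then 6
  else if j = 4 then 2 else 5

def sF (i : ℕ) : ℕ := if i = 1 then 6 else if i = 3 then 0 else 2

theorem goodF : Good 3 PF DF sF 4 1 := by
  constructor
  · intro j hj; interval_cases j <;> decide
  · intro i j hi hj hp h; interval_cases i <;> interval_cases j <;> revert hp h <;> decide
  · intro j hj; interval_cases j <;> decide
  · intro j hj; interval_cases j <;> decide
  · intro i j hi hj h; interval_cases i <;> interval_cases j <;> revert h <;> decide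
  · decide
  · omega
  · omega
  · intro i hi hp
    obtain rfl | rfl | rfl : i = 1 ∨ i = 3 ∨ i = 5 := by omega
    all_goals decide
  · intro i j hi hj hp hq h
    interval_cases i <;> interval_cases j <;> revert hp hq h <;> decide

def cyc (k : ℕ) (P : ℕ → ℤ) (b : Bool) (j : ZMod (2 * k + 1)) : Pt (2 * k + 1) :=
  ((P j.val : ZMod (2 * (2 * k + 1))), xor b (decide (j.val % 2 = 1)))

theorem val_succ_cyc (k : ℕ) (hk : 1 ≤ k) (j : ZMod (2 * k + 1)) :
    (j + 1).val = if j.val = 2 * k then 0 else j.val + 1 := by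
  have hj := ZMod.val_lt j
  rw [ZMod.val_add, ZMod.val_one_eq_one_mod, Nat.mod_eq_of_lt (show 1 < 2 * k + 1 by omega)]
  split_ifs with h
  · rw [h]; simp
  · rw [Nat.mod_eq_of_lt (by omega)]

theorem val_le_cyc (k : ℕ) (j : ZMod (2 * k + 1)) : j.val ≤ 2 * k := by
  have := ZMod.val_lt j; omega

theorem mixed_iff (k : ℕ) (hk : 1 ≤ k) (P : ℕ → ℤ) (b : Bool) (j : ZMod (2 * k + 1)) :
    mixedEdge (cyc k P b) j ↔ j.val < 2 * k := by
  have hj := val_le_cyc k j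
  unfold mixedEdge cyc
  simp only [val_succ_cyc k hk]
  by_cases h : j.val = 2 * k
  · rw [if_pos h, h]
    simp
  · rw [if_neg h]
    rcases Nat.mod_two_eq_zero_or_one j.val with e | e
    · have e2 : (j.val + 1) % 2 = 1 := by omega
      rw [e, e2]
      cases b <;> simp <;> omega
    · have e2 : (j.val + 1) % 2 = 0 := by omega
      rw [e, e2]
      cases b <;> simp <;> omega

def Ed (P : ℕ → ℤ) (b : Bool) (v : ℕ) : ℤ :=
  if xor b (decide (v % 2 = 1)) = false then P (v + 1) - P v else P v - P (v + 1)

theorem Ed_not (P : ℕ → ℤ) (v : ℕ) : Ed P true v = - Ed P false v := by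
  unfold Ed
  rcases Nat.mod_two_eq_zero_or_one v with e | e <;> simp [e]

theorem mixedDiff_cyc (k : ℕ) (hk : 1 ≤ k) (P : ℕ → ℤ) (b : Bool) (j : ZMod (2 * k + 1))
    (h : j.val < 2 * k) :
    mixedDiff (cyc k P b) j = ((Ed P b j.val : ℤ) : ZMod (2 * (2 * k + 1))) := by
  unfold mixedDiff cyc Ed
  simp only [val_succ_cyc k hk]
  rw [if_neg (show ¬ j.val = 2 * k by omega)]
  split_ifs <;> push_cast <;> rfl

section
variable {k : ℕ} {P D : ℕ → ℤ} {σ : ℕ → ℕ} {j0 m : ℕ}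

theorem Good.Ed_abs (g : Good k P D σ j0 m) (b : Bool) (v : ℕ) (h : v < 2 * k) :
    Ed P b v = D v ∨ Ed P b v = - D v := by
  unfold Ed
  rcases g.step v h with e | e <;> rw [e] <;> split_ifs <;> simp

theorem Good.surj (g : Good k P D σ j0 m) (a : ℤ) (h1 : 1 ≤ a) (h2 : a ≤ 2 * k) :
    ∃ v, v < 2 * k ∧ D v = a := by
  have : (Finset.range (2 * k)).image D = Finset.Icc 1 (2 * k : ℤ) := by
    apply Finset.eq_of_subset_of_card_le
    · intro x hx
      rw [Finset.mem_image] at hx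
      obtain ⟨i, hi, rfl⟩ := hx
      rw [Finset.mem_range] at hi
      rw [Finset.mem_Icc]
      exact g.dB i hi
    · rw [Finset.card_image_of_injOn]
      · simp
      · intro i hi j hj e
        simp only [Finset.coe_range, Set.mem_Iio] at hi hj
        exact g.dInj i j hi hj e
  have ha : a ∈ (Finset.range (2 * k)).image D := by
    rw [this, Finset.mem_Icc]; exact ⟨h1, h2⟩
  rw [Finset.mem_image] at ha
  obtain ⟨v, hv, e⟩ := ha
  exact ⟨v, Finset.mem_range.1 hv, e⟩

theorem cast_eq_small (k : ℕ) (x y : ℤ) (h : (x : ZMod (2 * (2 * k + 1))) = y)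
    (h1 : x - y < 4 * k + 2) (h2 : y - x < 4 * k + 2) : x = y := by
  rw [ZMod.intCast_eq_intCast_iff_dvd_sub] at h
  have := Int.eq_zero_of_abs_lt_dvd h (by push_cast; rw [abs_lt]; constructor <;> omega)
  omega

theorem Good.cyc_inj (g : Good k P D σ j0 m) (b : Bool) : Function.Injective (cyc k P b) := by
  intro i j h
  unfold cyc at h
  rw [Prod.mk.injEq] at h
  have hi := val_le_cyc k i
  have hj := val_le_cyc k j
  have b1 := g.bd _ hi
  have b2 := g.bd _ hj
  have e1 := cast_eq_small k _ _ h.1 (by omega) (by omega)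
  have e2 : i.val % 2 = j.val % 2 := by
    have h2 := h.2
    rw [Bool.xor_right_inj, decide_eq_decide] at h2
    omega
  exact ZMod.val_injective _ (g.inj _ _ hi hj e2 e1)

theorem Good.cyc_ne (g : Good k P D σ j0 m) (hk : 1 ≤ k) (b : Bool) (j : ZMod (2 * k + 1))
    (h : mixedEdge (cyc k P b) j) : mixedDiff (cyc k P b) j ≠ 0 ∧
      mixedDiff (cyc k P b) j ≠ ((2 * k + 1 : ℕ) : ZMod (2 * (2 * k + 1))) := by
  rw [mixed_iff k hk] at h
  rw [mixedDiff_cyc k hk P b j h]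
  have a := g.Ed_abs b _ h
  have c := g.dB _ h
  constructor
  · intro e
    have := cast_eq_small k _ 0 (by simpa using e) (by omega) (by omega)
    omega
  · intro e
    have := cast_eq_small k _ (2 * k + 1 : ℕ) (by rw [e]; simp) (by omega) (by omega)
    omega

theorem Good.cyc_ex (g : Good k P D σ j0 m) (hk : 1 ≤ k) (d : ZMod (2 * (2 * k + 1)))
    (hd0 : d ≠ 0) (hd1 : d ≠ ((2 * k + 1 : ℕ) : ZMod (2 * (2 * k + 1)))) :
    ∃! e : Bool × ZMod (2 * k + 1), mixedEdge (cyc k P e.1) e.2 ∧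
      mixedDiff (cyc k P e.1) e.2 = d := by
  have hn := ZMod.val_lt d
  have hd : ((d.val : ℕ) : ZMod (2 * (2 * k + 1))) = d := ZMod.natCast_zmod_val d
  have n0 : d.val ≠ 0 := by intro h; apply hd0; rw [← hd, h]; simp
  have n1 : d.val ≠ 2 * k + 1 := by intro h; apply hd1; rw [← hd, h]
  obtain ⟨a, ha, a1, a2, a0⟩ : ∃ a : ℤ, (a : ZMod (2 * (2 * k + 1))) = d ∧ a ≤ 2 * k ∧
      -(2 * k : ℤ) ≤ a ∧ a ≠ 0 := by
    by_cases h : d.val ≤ 2 * k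
    · exact ⟨d.val, by rw [← hd]; simp, by omega, by omega, by omega⟩
    · refine ⟨d.val - (2 * (2 * k + 1) : ℕ), ?_, by omega, by omega, by omega⟩
      rw [Int.cast_sub, Int.cast_natCast, Int.cast_natCast, ZMod.natCast_self, hd, sub_zero]
  obtain ⟨v, hv, hDv⟩ := g.surj |a| (by have := abs_pos.2 a0; omega)
    (by rw [abs_le]; omega)
  have hjv : ((v : ℕ) : ZMod (2 * k + 1)).val = v := by
    rw [ZMod.val_natCast, Nat.mod_eq_of_lt (by omega)]
  have hDv2 : D v = a ∨ D v = -a := by rw [hDv]; exact abs_choice a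
  have key : ∀ b (j : ZMod (2 * k + 1)), mixedEdge (cyc k P b) j ∧ mixedDiff (cyc k P b) j = d ↔
      j = (v : ZMod (2 * k + 1)) ∧ Ed P b v = a := by
    intro b j
    rw [mixed_iff k hk]
    constructor
    · rintro ⟨h1, h2⟩
      rw [mixedDiff_cyc k hk P b j h1, ← ha] at h2
      have x := g.Ed_abs b _ h1
      have y := g.dB _ h1
      have z := g.dB _ hv
      have e := cast_eq_small k _ _ h2 (by omega) (by omega)
      have hjj : j.val = v := g.dInj _ _ h1 hv (by omega)
      refine ⟨?_, by rw [← hjj]; exact e⟩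
      rw [← hjj]; exact (ZMod.natCast_zmod_val j).symm
    · rintro ⟨rfl, h⟩
      refine ⟨by rw [hjv]; exact hv, ?_⟩
      rw [mixedDiff_cyc k hk P b _ (by rw [hjv]; exact hv), hjv, h, ha]
  have hEn := Ed_not P v
  have hEa := g.Ed_abs false v hv
  by_cases hb : Ed P false v = a
  · refine ⟨(false, v), (key _ _).2 ⟨rfl, hb⟩, ?_⟩
    rintro ⟨b, j⟩ h
    obtain ⟨h1, h2⟩ := (key b j).1 h
    cases b
    · rw [h1]
    · exfalso; omega
  · refine ⟨(true, v), (key true _).2 ⟨rfl, by omega⟩, ?_⟩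
    rintro ⟨b, j⟩ h
    obtain ⟨h1, h2⟩ := (key b j).1 h
    cases b
    · exfalso; omega
    · rw [h1]

theorem cyc_pure_iff (hk : 1 ≤ k) (b : Bool) (j : ZMod (2 * k + 1)) :
    ¬ mixedEdge (cyc k P b) j ↔ j = ((2 * k : ℕ) : ZMod (2 * k + 1)) := by
  rw [mixed_iff k hk]
  have hj := val_le_cyc k j
  constructor
  · intro h
    have : j.val = 2 * k := by omega
    exact (ZMod.natCast_zmod_val j).symm.trans (congrArg _ this)
  · rintro rfl
    rw [ZMod.val_natCast, Nat.mod_eq_of_lt (by omega)]; omega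

theorem Good.cyc_pure (g : Good k P D σ j0 m) (hk : 1 ≤ k) (b : Bool) (j : ZMod (2 * k + 1))
    (h : ¬ mixedEdge (cyc k P b) j) : pureEdge (cyc k P b) b j ∧
      (pureDiff (cyc k P b) j = (m : ZMod (2 * (2 * k + 1))) ∨
       pureDiff (cyc k P b) j = -(m : ZMod (2 * (2 * k + 1)))) := by
  rw [mixed_iff k hk] at h
  have hj := val_le_cyc k j
  have hv : j.val = 2 * k := by omega
  have hs := val_succ_cyc k hk j
  rw [if_pos hv] at hs
  unfold pureEdge pureDiff cyc
  simp only [hs, hv]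
  refine ⟨by simp, ?_⟩
  rcases g.fin with e | e
  · right; rw [e]; push_cast; ring
  · left; rw [e]; push_cast; ring

theorem Good.cyc_eq (g : Good k P D σ j0 m) (b : Bool) (t : ZMod (2 * (2 * k + 1))) :
    IsEquitable (stdColour (2 * k + 1)) (cycTranslate t (cyc k P b)) := by
  have hs := g.sum t.val
  have hval : ∀ v : ℕ, (((P v : ZMod (2 * (2 * k + 1))) + t).val : ℤ) =
      (P v + t.val) % (2 * (2 * k + 1)) := by
    intro v
    have : (P v : ZMod (2 * (2 * k + 1))) + t =
        ((P v + (t.val : ℤ) : ℤ) : ZMod (2 * (2 * k + 1))) := by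
      push_cast; rw [ZMod.natCast_zmod_val]
    rw [this, ZMod.val_intCast]; push_cast; rfl
  have hcount : (redCount (stdColour (2 * k + 1)) (cycTranslate t (cyc k P b)) : ℤ) =
      ∑ v ∈ Finset.range (2 * k + 1),
        (if xor b (decide (v % 2 = 1)) then 1 - hInd (2 * k + 1) (P v + t.val)
          else hInd (2 * k + 1) (P v + t.val)) := by
    unfold redCount
    rw [Finset.card_filter, Nat.cast_sum]
    rw [Finset.sum_range]
    change ∑ i : Fin (2 * k + 1), _ = _
    apply Finset.sum_congr rfl
    intro i _
    change ((if stdColour (2 * k + 1) (((P i.val : ZMod (2 * (2 * k + 1))) + t),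
      xor b (decide (i.val % 2 = 1))) = true then 1 else 0 : ℕ) : ℤ) = _
    have hv := hval i.val
    unfold stdColour hInd
    rw [← hv]
    have hc : ((((P i.val : ZMod (2 * (2 * k + 1))) + t).val : ℤ) < 2 * (k : ℤ) + 1) ↔
      ((P i.val : ZMod (2 * (2 * k + 1))) + t).val < 2 * k + 1 := by omega
    simp only [hc]
    generalize xor b (decide (i.val % 2 = 1)) = c
    by_cases hx : ((P i.val : ZMod (2 * (2 * k + 1))) + t).val < 2 * k + 1 <;>
      cases c <;> simp [hx]
  unfold IsEquitable
  have d1 : (2 * k + 1) / 2 = k := by omega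
  have d2 : (2 * k + 1 + 1) / 2 = k + 1 := by omega
  rw [d1, d2]
  cases b
  · simp only [Bool.false_xor, decide_eq_true_eq] at hcount
    rw [← hcount] at hs
    dsimp only at hs
    omega
  · have : (redCount (stdColour (2 * k + 1)) (cycTranslate t (cyc k P true)) : ℤ) +
      ∑ v ∈ Finset.range (2 * k + 1),
      (if v % 2 = 1 then 1 - hInd (2 * k + 1) (P v + t.val)
        else hInd (2 * k + 1) (P v + t.val)) = 2 * k + 1 := by
      rw [hcount, ← Finset.sum_add_distrib]
      rw [Finset.sum_congr rfl (g := fun _ => (1 : ℤ))]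
      · simp
      · intro v _
        rcases Nat.mod_two_eq_zero_or_one v with e | e <;> simp [e]
    dsimp only at hs
    omega

end

theorem Good.main {k : ℕ} {P D : ℕ → ℤ} {σ : ℕ → ℕ} {j0 m : ℕ} (g : Good k P D σ j0 m)
    (hk : 1 ≤ k) :
    ∃ C : Bool → ZMod (2 * k + 1) → Pt (2 * k + 1),
      (∀ b, Function.Injective (C b)) ∧
      (∀ d : ZMod (2 * (2 * k + 1)), d ≠ 0 → d ≠ ((2 * k + 1 : ℕ) : ZMod (2 * (2 * k + 1))) →
        ∃! e : Bool × ZMod (2 * k + 1), mixedEdge (C e.1) e.2 ∧ mixedDiff (C e.1) e.2 = d) ∧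
      (∀ b j, mixedEdge (C b) j →
        mixedDiff (C b) j ≠ 0 ∧
          mixedDiff (C b) j ≠ ((2 * k + 1 : ℕ) : ZMod (2 * (2 * k + 1)))) ∧
      (∀ b, ∃! j, ¬ mixedEdge (C b) j) ∧
      (∀ b j, ¬ mixedEdge (C b) j → pureEdge (C b) b j ∧
        (pureDiff (C b) j = (m : ZMod (2 * (2 * k + 1))) ∨
          pureDiff (C b) j = -(m : ZMod (2 * (2 * k + 1))))) ∧
      (∀ b, ∀ t : ZMod (2 * (2 * k + 1)),
        IsEquitable (stdColour (2 * k + 1)) (cycTranslate t (C b))) := by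
  refine ⟨cyc k P, g.cyc_inj, g.cyc_ex hk, g.cyc_ne hk, ?_, g.cyc_pure hk, g.cyc_eq⟩
  intro b
  refine ⟨((2 * k : ℕ) : ZMod (2 * k + 1)), (cyc_pure_iff hk b _).2 rfl, ?_⟩
  intro j hj
  exact (cyc_pure_iff hk b j).1 hj


theorem exists_good (k : ℕ) (hk : 3 ≤ k) : ∃ P D σ j0 m, Good k P D σ j0 m ∧
    (m = k ∨ (k = 3 ∧ m = 1)) := by
  obtain ⟨r, h⟩ : ∃ r, k = 4 * r ∨ k = 4 * r + 1 ∨ k = 4 * r + 2 ∨ k = 4 * r + 3 :=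
    ⟨k / 4, by omega⟩
  rcases h with rfl | rfl | rfl | rfl
  · exact ⟨_, _, _, _, _, goodA r (by omega), Or.inl rfl⟩
  · exact ⟨_, _, _, _, _, goodE r (by omega), Or.inl rfl⟩
  · exact ⟨_, _, _, _, _, goodB r (by omega), Or.inl rfl⟩
  · by_cases hr : r = 0
    · subst hr
      exact ⟨_, _, _, _, _, goodF, Or.inr ⟨rfl, rfl⟩⟩
    · exact ⟨_, _, _, _, _, goodC r (by omega), Or.inl rfl⟩

theorem stmt5 (ℓ : ℕ) (hℓ : 7 ≤ ℓ) (hodd : Odd ℓ) :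
    letI : NeZero ℓ := ⟨by omega⟩
    ∃ m ∈ ({(ℓ - 5) / 2, (ℓ - 3) / 2, (ℓ - 1) / 2, (ℓ + 1) / 2} : Set ℕ),
    ∃ C : Bool → ZMod ℓ → Pt ℓ,
      (∀ b, Function.Injective (C b)) ∧
      -- (i) the mixed differences of the mixed edges of `C false` and `C true`
      -- are precisely the elements of {1, …, 2ℓ-1} \ {ℓ}, each occurring exactly once
      -- (in particular there are exactly 2ℓ-2 mixed edges)
      (∀ d : ZMod (2 * ℓ), d ≠ 0 → d ≠ (ℓ : ZMod (2 * ℓ)) →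
        ∃! e : Bool × ZMod ℓ, mixedEdge (C e.1) e.2 ∧ mixedDiff (C e.1) e.2 = d) ∧
      (∀ b j, mixedEdge (C b) j →
        mixedDiff (C b) j ≠ 0 ∧ mixedDiff (C b) j ≠ (ℓ : ZMod (2 * ℓ))) ∧
      -- (ii) each cycle `C i` has exactly one pure edge, which is `i`-pure of difference ±m
      (∀ b, ∃! j, ¬ mixedEdge (C b) j) ∧
      (∀ b j, ¬ mixedEdge (C b) j → pureEdge (C b) b j ∧
        (pureDiff (C b) j = (m : ZMod (2 * ℓ)) ∨ pureDiff (C b) j = -(m : ZMod (2 * ℓ)))) ∧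
      -- (iii) every cycTranslate of each cycle is equitably 2-coloured
      (∀ b, ∀ t : ZMod (2 * ℓ), IsEquitable (stdColour ℓ) (cycTranslate t (C b))) := by
  obtain ⟨k, rfl⟩ := hodd
  obtain ⟨P, D, σ, j0, m, g, hm⟩ := exists_good k (by omega)
  refine ⟨m, ?_, g.main (by omega)⟩
  simp only [Set.mem_insert_iff, Set.mem_singleton_iff]
  omega
end

section
/- Let ℓ ≥ 7 be an odd integer and let v be a positive integer with v ≡ 1 (mod 2ℓ). Then the complete graph K_v admits an equitably 2-colourable ℓ-cycle decomposition. -/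
namespace EqCyc

/-- cycle from a function on naturals -/
def mk {V : Type} (m : ℕ) (f : ℕ → V) : ZMod (2 * m + 1) → V := fun j => f j.val

lemma mk_inj {V : Type} (m : ℕ) (f : ℕ → V)
    (h : ∀ k k', k < k' → k' < 2 * m + 1 → f k ≠ f k') : Function.Injective (mk m f) := by
  intro a b hab
  have ha := ZMod.val_lt a
  have hb := ZMod.val_lt b
  apply ZMod.val_injective
  rcases lt_trichotomy a.val b.val with hl | hl | hl
  · exact absurd hab (h _ _ hl hb)
  · exact hl
  · exact absurd hab.symm (h _ _ hl ha)

lemma mk_edge {V : Type} (m : ℕ) (f : ℕ → V) (k : ℕ) (hk : k < 2 * m) :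
    s(f k, f (k + 1)) ∈ cycEdges (mk m f) := by
  refine ⟨(k : ZMod (2 * m + 1)), ?_⟩
  have h1 : ((k : ZMod (2 * m + 1))).val = k := ZMod.val_cast_of_lt (by omega)
  have h2 : ((k : ZMod (2 * m + 1)) + 1).val = k + 1 := by
    have := ZMod.val_cast_of_lt (n := 2 * m + 1) (a := k + 1) (by omega)
    push_cast at this
    exact this
  simp only [mk, h1, h2]

lemma mk_edge_last {V : Type} (m : ℕ) (f : ℕ → V) :
    s(f (2 * m), f 0) ∈ cycEdges (mk m f) := by
  refine ⟨((2 * m : ℕ) : ZMod (2 * m + 1)), ?_⟩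
  have h1 : (((2 * m : ℕ) : ZMod (2 * m + 1))).val = 2 * m := ZMod.val_cast_of_lt (by omega)
  have h2 : (((2 * m : ℕ) : ZMod (2 * m + 1)) + 1) = 0 := by
    have := ZMod.natCast_self (2 * m + 1)
    push_cast at this ⊢
    exact this
  simp only [mk, h1, h2, ZMod.val_zero]

lemma mk_red {V : Type} (m : ℕ) (f : ℕ → V) (c : V → Bool) :
    redCount c (mk m f) = ∑ k ∈ Finset.range (2 * m + 1), if c (f k) = true then 1 else 0 := by
  unfold redCount mk
  rw [Finset.card_filter]
  exact Fin.sum_univ_eq_sum_range (fun k => if c (f k) = true then 1 else 0) (2 * m + 1)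

lemma transfer {V W : Type} (n : ℕ) [NeZero n] (e : V ≃ W)
    (h : HasEquitable2Decomp (⊤ : SimpleGraph V) n) :
    HasEquitable2Decomp (⊤ : SimpleGraph W) n := by
  obtain ⟨ι, cyc, c, ⟨h1, h2, h3⟩, h4⟩ := h
  refine ⟨ι, fun i j => e (cyc i j), fun w => c (e.symm w), ⟨?_, ?_, ?_⟩, ?_⟩
  · intro i
    exact e.injective.comp (h1 i)
  · intro i j
    have := h2 i j
    simpa using this
  · intro d
    have key : ∀ i, d ∈ cycEdges (fun j => e (cyc i j)) ↔ d.map e.symm ∈ cycEdges (cyc i) := by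
      intro i
      unfold cycEdges
      constructor
      · rintro ⟨j, rfl⟩
        exact ⟨j, by simp⟩
      · rintro ⟨j, hj⟩
        refine ⟨j, ?_⟩
        have := congrArg (Sym2.map e) hj
        simpa [Sym2.map_map] using this
    simp only [key]
    rw [← h3]
    induction d using Sym2.ind with
    | _ a b => simp
  · intro i
    have := h4 i
    simpa [IsEquitable, redCount] using this

lemma decomp_of_surj {V ι : Type} [Fintype V] [DecidableEq V] [Fintype ι] (m : ℕ) (hm : 1 ≤ m)
    (f : ι → ℕ → V) (c : V → Bool)
    (hinj : ∀ i k k', k < k' → k' < 2 * m + 1 → f i k ≠ f i k')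
    (hsurj : ∀ u w : V, u ≠ w → ∃ i, s(u, w) ∈ cycEdges (mk m (f i)))
    (hcard : Fintype.card ι * (2 * m + 1) = (Fintype.card V).choose 2)
    (hred : ∀ i, (∑ k ∈ Finset.range (2 * m + 1), if c (f i k) = true then 1 else 0) = m ∨
      (∑ k ∈ Finset.range (2 * m + 1), if c (f i k) = true then 1 else 0) = m + 1) :
    HasEquitable2Decomp (⊤ : SimpleGraph V) (2 * m + 1) := by
  have hadj : ∀ i j, (⊤ : SimpleGraph V).Adj (mk m (f i) j) (mk m (f i) (j + 1)) := by
    intro i j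
    rw [SimpleGraph.top_adj]
    intro h
    have hj := mk_inj m (f i) (hinj i) h
    have hF : Fact (1 < 2 * m + 1) := ⟨by omega⟩
    exact one_ne_zero (left_eq_add.1 hj)
  refine ⟨ι, fun i => mk m (f i), c, ⟨fun i => mk_inj m _ (hinj i), hadj, ?_⟩, ?_⟩
  · let Φ : ι × ZMod (2 * m + 1) → (⊤ : SimpleGraph V).edgeSet :=
      fun p => ⟨s(mk m (f p.1) p.2, mk m (f p.1) (p.2 + 1)), hadj p.1 p.2⟩
    have hs : Function.Surjective Φ := by
      rintro ⟨d, hd⟩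
      induction d using Sym2.ind with
      | _ a b =>
        have hab : a ≠ b := by simpa using hd
        obtain ⟨i, j, hj⟩ := hsurj a b hab
        exact ⟨(i, j), Subtype.ext hj⟩
    have hc : Fintype.card (ι × ZMod (2 * m + 1)) =
        Fintype.card (⊤ : SimpleGraph V).edgeSet := by
      rw [Fintype.card_prod, ZMod.card, hcard, ← SimpleGraph.edgeFinset_card,
        SimpleGraph.card_edgeFinset_top_eq_card_choose_two]
    have hb : Function.Bijective Φ := (Fintype.bijective_iff_surjective_and_card Φ).2 ⟨hs, hc⟩
    intro d
    constructor
    · intro hd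
      obtain ⟨⟨i, j⟩, hij⟩ := hs ⟨d, hd⟩
      refine ⟨i, ⟨j, congrArg Subtype.val hij⟩, ?_⟩
      rintro i' ⟨j', hj'⟩
      have : Φ (i', j') = Φ (i, j) := by
        rw [hij]
        exact Subtype.ext hj'
      exact congrArg Prod.fst (hb.1 this)
    · rintro ⟨i, ⟨j, rfl⟩, -⟩
      exact hadj i j
  · intro i
    unfold IsEquitable
    rw [mk_red]
    have h1 : (2 * m + 1) / 2 = m := by omega
    have h2 : (2 * m + 1 + 1) / 2 = m + 1 := by omega
    rw [h1, h2]
    exact hred i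

/-! levels -/

lemma cast_inj {m : ℕ} {a b : ℤ} (h : ((a : ℤ) : ZMod (2 * m + 1)) = (b : ℤ))
    (h1 : a - b < 2 * m + 1) (h2 : b - a < 2 * m + 1) : a = b := by
  rw [ZMod.intCast_eq_intCast_iff_dvd_sub] at h
  obtain ⟨k, hk⟩ := h
  push_cast at hk
  have : k = 0 := by
    by_contra hne
    rcases lt_or_gt_of_ne hne with h | h
    · nlinarith
    · nlinarith
  subst this
  omega

lemma exists_rep {m : ℕ} (d : ZMod (2 * m + 1)) :
    ∃ z : ℤ, ((z : ℤ) : ZMod (2 * m + 1)) = d ∧ -(m : ℤ) ≤ z ∧ z ≤ m := by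
  have hd := ZMod.val_lt d
  by_cases h : d.val ≤ m
  · exact ⟨d.val, by simp, by omega, by omega⟩
  · refine ⟨(d.val : ℤ) - (2 * m + 1 : ℕ), ?_, by push_cast; omega, by push_cast; omega⟩
    rw [Int.cast_sub, Int.cast_natCast, Int.cast_natCast, ZMod.natCast_self]
    simp

/-- zigzag -/
def zz (n k : ℕ) : ℤ := if k % 2 = 0 then ((k / 2 : ℕ) : ℤ) else (n : ℤ) - 1 - ((k / 2 : ℕ) : ℤ)

/-! quasigroup -/
abbrev Q (t : ℕ) := Fin t × Bool

def ev {t : ℕ} (a : Q t) : ℕ := if a.2 then a.1.val else a.1.val + t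

lemma ev_lt {t : ℕ} (a : Q t) : ev a < 2 * t := by
  have := a.1.isLt
  unfold ev; split <;> omega

def op {t : ℕ} (a b : Q t) : Q t :=
  (⟨((ev a + ev b) % (2 * t)) / 2, by
    have := a.1.isLt
    have := Nat.mod_lt (ev a + ev b) (show 2 * t > 0 by omega)
    omega⟩, decide (((ev a + ev b) % (2 * t)) % 2 = 0))

lemma op_comm {t : ℕ} (a b : Q t) : op a b = op b a := by
  unfold op; simp only [Nat.add_comm (ev a) (ev b)]

lemma op_diag {t : ℕ} (p : Fin t) (b : Bool) : op (p, b) (p, b) = (p, true) := by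
  have hp := p.isLt
  have : (ev (p, b) + ev (p, b)) % (2 * t) = 2 * p.val := by
    cases b
    · have : ev (p, false) + ev (p, false) = 2 * p.val + 2 * t := by simp [ev]; omega
      rw [this, Nat.add_mod_right, Nat.mod_eq_of_lt (by omega)]
    · have : ev (p, true) + ev (p, true) = 2 * p.val := by simp [ev]; omega
      rw [this, Nat.mod_eq_of_lt (by omega)]
  unfold op
  simp only [this]
  ext <;> simp

lemma op_surj {t : ℕ} (a c : Q t) : ∃ b, op a b = c := by
  obtain ⟨r, β⟩ := c
  have hr := r.isLt
  have ha := ev_lt a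
  obtain ⟨s, hs, hs1, hs2⟩ : ∃ s : ℕ, s < 2 * t ∧ s / 2 = r.val ∧ decide (s % 2 = 0) = β := by
    cases β
    · exact ⟨2 * r.val + 1, by omega, by omega, by simp⟩
    · exact ⟨2 * r.val, by omega, by omega, by simp⟩
  obtain ⟨n, hn, hn2⟩ : ∃ n : ℕ, n < 2 * t ∧ (ev a + n) % (2 * t) = s := by
    by_cases h : ev a ≤ s
    · refine ⟨s - ev a, by omega, ?_⟩
      rw [Nat.add_sub_cancel' h, Nat.mod_eq_of_lt hs]
    · refine ⟨s + 2 * t - ev a, by omega, ?_⟩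
      rw [Nat.add_sub_cancel' (by omega), Nat.add_mod_right, Nat.mod_eq_of_lt hs]
  obtain ⟨b, hb⟩ : ∃ b : Q t, ev b = n := by
    by_cases h : n < t
    · exact ⟨(⟨n, h⟩, true), by simp [ev]⟩
    · exact ⟨(⟨n - t, by omega⟩, false), by simp [ev]; omega⟩
  refine ⟨b, ?_⟩
  unfold op
  simp only [hb, hn2, hs2]
  ext
  · simp [hs1]
  · simp

abbrev W (t m : ℕ) := Option (Fin t × Bool × ZMod (2 * m + 1))

def col {t m : ℕ} : W t m → Bool
  | none => false
  | some x => x.2.1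

/-! Z-cycles -/

def Z {t m : ℕ} (p q : Fin t) (τ : ℕ → Bool) (e : Q t) (i : ZMod (2 * m + 1)) (k : ℕ) : W t m :=
  if k < 2 * m then some (if k % 2 = 0 then p else q, τ k, i + ((zz m k : ℤ) : ZMod (2 * m + 1)))
  else some (e.1, e.2, i + ((m : ℤ) : ZMod (2 * m + 1)))

lemma zz_bd {m k : ℕ} (h : k < 2 * m) : 0 ≤ zz m k ∧ zz m k < m := by
  unfold zz; split <;> omega

lemma Z_inj {t m : ℕ} (p q : Fin t) (τ : ℕ → Bool) (e : Q t) (i : ZMod (2 * m + 1))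
    (h : p ≠ q ∨ ∀ k < m, τ k ≠ τ (2 * m - 1 - k)) (k k' : ℕ) (hk : k < k')
    (hk' : k' < 2 * m + 1) : Z p q τ e i k ≠ Z p q τ e i k' := by
  intro he
  have b1 := zz_bd (m := m) (k := k) (by omega)
  unfold Z at he
  rw [if_pos (show k < 2 * m by omega)] at he
  by_cases hl : k' < 2 * m
  · rw [if_pos hl] at he
    have b2 := zz_bd hl
    simp only [Option.some.injEq, Prod.mk.injEq, add_right_inj] at he
    obtain ⟨h1, h2, h3⟩ := he
    have h4 := cast_inj h3 (by omega) (by omega)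
    have h5 : k' = 2 * m - 1 - k ∧ k < m ∧ k % 2 ≠ k' % 2 := by
      unfold zz at h4; split at h4 <;> split at h4 <;> omega
    obtain ⟨h5, h6, h7⟩ := h5
    rcases h with h | h
    · by_cases e0 : k % 2 = 0
      · rw [if_pos e0, if_neg (by omega)] at h1; exact h h1
      · rw [if_neg e0, if_pos (by omega)] at h1; exact h h1.symm
    · exact h k h6 (h5 ▸ h2)
  · rw [if_neg hl] at he
    simp only [Option.some.injEq, Prod.mk.injEq, add_right_inj] at he
    have h4 := cast_inj he.2.2 (by omega) (by omega)
    omega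

lemma Z_e {t m : ℕ} (p q : Fin t) (τ : ℕ → Bool) (e : Q t) (i : ZMod (2 * m + 1)) (k : ℕ)
    (h : k < 2 * m) (h2 : k % 2 = 0) :
    Z p q τ e i k = some (p, τ k, i + ((zz m k : ℤ) : ZMod (2 * m + 1))) := by
  rw [Z, if_pos h, if_pos h2]

lemma Z_o {t m : ℕ} (p q : Fin t) (τ : ℕ → Bool) (e : Q t) (i : ZMod (2 * m + 1)) (k : ℕ)
    (h : k < 2 * m) (h2 : k % 2 ≠ 0) :
    Z p q τ e i k = some (q, τ k, i + ((zz m k : ℤ) : ZMod (2 * m + 1))) := by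
  rw [Z, if_pos h, if_neg h2]

lemma Z_red {t m : ℕ} (p q : Fin t) (τ : ℕ → Bool) (e : Q t) (i : ZMod (2 * m + 1))
    (h : (∑ k ∈ Finset.range (2 * m), if τ k = true then 1 else 0) = m) :
    (∑ k ∈ Finset.range (2 * m + 1), if col (Z p q τ e i k) = true then 1 else 0) = m ∨
    (∑ k ∈ Finset.range (2 * m + 1), if col (Z p q τ e i k) = true then 1 else 0) = m + 1 := by
  have : (∑ k ∈ Finset.range (2 * m), if col (Z p q τ e i k) = true then 1 else 0) = m := by
    refine Eq.trans (Finset.sum_congr rfl ?_) h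
    intro k hk
    rw [Finset.mem_range] at hk
    simp [Z, hk, col]
  rw [Finset.sum_range_succ, this]
  split
  · right; rfl
  · left; rfl

lemma lev {n : ℕ} (a : ZMod n) (x y z : ℤ) (h : x = z - y) :
    a + (x : ZMod n) = a - (y : ZMod n) + (z : ZMod n) := by
  rw [h]; push_cast; ring

lemma Z_cover {t m : ℕ} (p q : Fin t) (τ : ℕ → Bool) (e : Q t) (k : ℕ) (hk : k + 1 < 2 * m)
    (a b : ZMod (2 * m + 1)) (hab : b = a + (((m : ℤ) - 1 - k : ℤ) : ZMod (2 * m + 1)))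
    (s s' : Bool) (hs : s = τ (if k % 2 = 0 then k else k + 1))
    (hs' : s' = τ (if k % 2 = 0 then k + 1 else k)) :
    ∃ i, s(some (p, s, a), some (q, s', b)) ∈ cycEdges (mk m (Z p q τ e i)) := by
  by_cases h : k % 2 = 0
  · refine ⟨a - ((k / 2 : ℕ) : ℤ), ?_⟩
    have := mk_edge m (Z p q τ e (a - (((k / 2 : ℕ) : ℤ) : ZMod (2 * m + 1)))) k (by omega)
    rw [Z_e _ _ _ _ _ k (by omega) h, Z_o _ _ _ _ _ (k + 1) (by omega) (by omega)] at this
    rw [if_pos h] at hs hs'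
    rw [hs, hs']
    convert this using 6
    · rw [zz, if_pos h]; ring
    · rw [hab, zz, if_neg (by omega)]
      exact lev _ _ _ _ (by omega)
  · refine ⟨a - (((k + 1) / 2 : ℕ) : ℤ), ?_⟩
    have := mk_edge m (Z p q τ e (a - ((((k + 1) / 2 : ℕ) : ℤ) : ZMod (2 * m + 1)))) k (by omega)
    rw [Z_o _ _ _ _ _ k (by omega) h, Z_e _ _ _ _ _ (k + 1) (by omega) (by omega)] at this
    rw [if_neg h] at hs hs'
    rw [hs, hs', Sym2.eq_swap]
    convert this using 6
    · rw [hab, zz, if_neg (by omega)]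
      exact lev _ _ _ _ (by omega)
    · rw [zz, if_pos (by omega)]; ring

lemma Z_first {t m : ℕ} (hm : 1 ≤ m) (p q : Fin t) (τ : ℕ → Bool) (e : Q t) (i : ZMod (2 * m + 1)) :
    s(some (p, τ 0, i), some (e.1, e.2, i + (m : ZMod (2 * m + 1)))) ∈
      cycEdges (mk m (Z p q τ e i)) := by
  have := mk_edge_last m (Z p q τ e i)
  rw [Z, Z, if_neg (by omega), if_pos (by omega), Sym2.eq_swap] at this
  simpa [zz] using this

lemma Z_last {t m : ℕ} (hm : 1 ≤ m) (p q : Fin t) (τ : ℕ → Bool) (e : Q t) (i : ZMod (2 * m + 1)) :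
    s(some (q, τ (2 * m - 1), i), some (e.1, e.2, i + (m : ZMod (2 * m + 1)))) ∈
      cycEdges (mk m (Z p q τ e i)) := by
  have := mk_edge m (Z p q τ e i) (2 * m - 1) (by omega)
  have h0 : zz m (2 * m - 1) = 0 := by unfold zz; split <;> omega
  rw [Z, Z, if_pos (by omega), if_neg (by omega), if_neg (by omega), h0] at this
  simpa using this

/-! block types -/

def pat (a b : Bool) (r : ℕ) : Bool :=
  if r = 0 then a else if r = 1 then !b else if r = 2 then !a else b

def tau (m : ℕ) (a b : Bool) (k : ℕ) : Bool :=
  if m % 2 = 0 then pat a b (k % 4)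
  else if k = 0 then a else if k = 1 then xor a b else if k = 2 then !a else if k = 3 then !b
  else if k = 4 then !(xor a b) else if k = 5 then b else pat a b ((k + 2) % 4)

lemma tau_zero (m : ℕ) (a b : Bool) : tau m a b 0 = a := by
  simp [tau, pat]

lemma tau_last (m : ℕ) (hm : 3 ≤ m) (a b : Bool) : tau m a b (2 * m - 1) = b := by
  unfold tau
  by_cases h : m % 2 = 0
  · rw [if_pos h, show (2 * m - 1) % 4 = 3 by omega]; simp [pat]
  · rw [if_neg h, if_neg (by omega), if_neg (by omega), if_neg (by omega), if_neg (by omega),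
      if_neg (by omega)]
    split
    · rfl
    · rw [show (2 * m - 1 + 2) % 4 = 3 by omega]; simp [pat]

lemma pat_cons (r : ℕ) (s s' : Bool) :
    ∃ a b, pat a b (r % 4) = s ∧ pat a b ((r + 1) % 4) = s' := by
  have : r % 4 = 0 ∧ (r + 1) % 4 = 1 ∨ r % 4 = 1 ∧ (r + 1) % 4 = 2 ∨
    r % 4 = 2 ∧ (r + 1) % 4 = 3 ∨ r % 4 = 3 ∧ (r + 1) % 4 = 0 := by omega
  rcases this with ⟨h, h'⟩ | ⟨h, h'⟩ | ⟨h, h'⟩ | ⟨h, h'⟩ <;> rw [h, h'] <;> revert s s' <;> decide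

lemma tau_cons (m k : ℕ) (s s' : Bool) :
    ∃ a b, tau m a b k = s ∧ tau m a b (k + 1) = s' := by
  unfold tau
  by_cases h : m % 2 = 0
  · simp only [if_pos h]
    exact pat_cons k s s'
  · simp only [if_neg h]
    by_cases h6 : 6 ≤ k
    · obtain ⟨a, b, h1, h2⟩ := pat_cons (k + 2) s s'
      refine ⟨a, b, ?_, ?_⟩
      · rw [if_neg (by omega), if_neg (by omega), if_neg (by omega), if_neg (by omega),
          if_neg (by omega), if_neg (by omega)]; exact h1
      · rw [if_neg (by omega), if_neg (by omega), if_neg (by omega), if_neg (by omega),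
          if_neg (by omega), if_neg (by omega), ← h2]
    · clear h
      have : k < 6 := by omega
      interval_cases k <;> revert s s' <;> decide

lemma tau_sum (m : ℕ) (hm : 3 ≤ m) (a b : Bool) :
    (∑ k ∈ Finset.range (2 * m), if tau m a b k = true then 1 else 0) = m := by
  by_cases h : m % 2 = 0
  · have key : ∀ n, (∑ k ∈ Finset.range (4 * n), if pat a b (k % 4) = true then 1 else 0) = 2 * n := by
      intro n
      induction n with
      | zero => simp
      | succ n ih =>
        rw [show 4 * (n + 1) = 4 * n + 1 + 1 + 1 + 1 by ring]
        simp only [Finset.sum_range_succ, ih]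
        rw [show (4 * n) % 4 = 0 by omega, show (4 * n + 1) % 4 = 1 by omega,
          show (4 * n + 1 + 1) % 4 = 2 by omega, show (4 * n + 1 + 1 + 1) % 4 = 3 by omega]
        cases a <;> cases b <;> simp [pat] <;> omega
    unfold tau
    simp only [if_pos h]
    rw [show 2 * m = 4 * (m / 2) by omega, key]; omega
  · have key : ∀ n, (∑ k ∈ Finset.range (6 + 4 * n), if tau m a b k = true then 1 else 0)
        = 2 * n + 3 := by
      intro n
      induction n with
      | zero =>
        simp only [Finset.sum_range_succ, tau, if_neg h]
        cases a <;> cases b <;> simp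
      | succ n ih =>
        rw [show 6 + 4 * (n + 1) = 6 + 4 * n + 1 + 1 + 1 + 1 by ring]
        simp only [Finset.sum_range_succ, ih]
        have e : ∀ j, tau m a b (6 + 4 * n + j) = pat a b (j % 4) := by
          intro j
          rw [tau, if_neg h, if_neg (by omega), if_neg (by omega), if_neg (by omega),
            if_neg (by omega), if_neg (by omega), if_neg (by omega)]
          congr 1; omega
        have e0 := e 0
        have e1 := e 1
        have e2 := e 2
        have e3 := e 3
        simp only [Nat.add_zero] at e0
        rw [e0, e1, show 6 + 4 * n + 1 + 1 = 6 + 4 * n + 2 by ring, e2,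
          show 6 + 4 * n + 2 + 1 = 6 + 4 * n + 3 by ring, e3]
        cases a <;> cases b <;> simp [pat] <;> omega
    have := key ((m - 3) / 2)
    rw [show 6 + 4 * ((m - 3) / 2) = 2 * m by omega] at this
    rw [this]; omega

/-! P types -/

def tauP (m k : ℕ) : Bool := decide (k = 0 ∨ (k % 2 = 1 ∧ k ≠ 2 * m - 1))

lemma tauP_sum (m : ℕ) (hm : 3 ≤ m) :
    (∑ k ∈ Finset.range (2 * m), if tauP m k = true then 1 else 0) = m := by
  have key : ∀ n, n + 1 ≤ m →
      (∑ k ∈ Finset.range (2 * n + 1), if tauP m k = true then 1 else 0) = n + 1 := by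
    intro n
    induction n with
    | zero => intro _; rw [Finset.sum_range_one, if_pos (by simp [tauP])]
    | succ n ih =>
      intro hn
      rw [show 2 * (n + 1) + 1 = 2 * n + 1 + 1 + 1 by ring]
      rw [Finset.sum_range_succ, Finset.sum_range_succ, ih (by omega)]
      have e1 : tauP m (2 * n + 1) = true := by simp only [tauP, decide_eq_true_eq]; omega
      have e2 : ¬ tauP m (2 * n + 1 + 1) = true := by simp only [tauP, decide_eq_true_eq]; omega
      rw [if_pos e1, if_neg e2]
  have := key (m - 1) (by omega)
  have e2 : ¬ tauP m (2 * (m - 1) + 1) = true := by simp only [tauP, decide_eq_true_eq]; omega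
  rw [show 2 * m = 2 * (m - 1) + 1 + 1 by omega, Finset.sum_range_succ, this, if_neg e2]; omega

lemma tauP_ne (m : ℕ) (k : ℕ) (hk : k < m) : tauP m k ≠ tauP m (2 * m - 1 - k) := by
  unfold tauP
  rw [Ne, decide_eq_decide]
  omega

/-! J-cycles -/

def wd (m : ℕ) : ℤ := (((m - 1) / 2 : ℕ) : ℤ)

def J {t m : ℕ} (p : Fin t) (i : ZMod (2 * m + 1)) (k : ℕ) : W t m :=
  if k = 0 then none else if k = 1 then some (p, true, i + ((0 : ℤ) : ZMod (2 * m + 1)))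
  else if k = 2 then
    (if (-i).val < m then some (p, true, i + ((m : ℤ) : ZMod (2 * m + 1)))
      else some (p, false, i + (((m : ℤ) + 1 : ℤ) : ZMod (2 * m + 1))))
  else if k ≤ m + 1 then some (p, true, i + ((-1 - zz (m - 1) (k - 3) : ℤ) : ZMod (2 * m + 1)))
  else some (p, false, i + (((m : ℤ) - 2 - wd m - zz (m - 1) (k - m - 2) : ℤ) : ZMod (2 * m + 1)))

/-- integer level of the J cycle -/
def Jl (m : ℕ) (T : Prop) [Decidable T] (k : ℕ) : ℤ :=
  if k = 1 then 0 else if k = 2 then (if T then (m : ℤ) else m + 1)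
  else if k ≤ m + 1 then -1 - zz (m - 1) (k - 3)
  else (m : ℤ) - 2 - wd m - zz (m - 1) (k - m - 2)

def Jc (m : ℕ) (T : Prop) [Decidable T] (k : ℕ) : Bool :=
  decide (k = 1 ∨ (k = 2 ∧ T) ∨ (3 ≤ k ∧ k ≤ m + 1))

lemma J_eq {t m : ℕ} (p : Fin t) (i : ZMod (2 * m + 1)) (k : ℕ) (hk : 1 ≤ k) :
    J p i k = some (p, Jc m ((-i).val < m) k,
      i + ((Jl m ((-i).val < m) k : ℤ) : ZMod (2 * m + 1))) := by
  unfold J Jc Jl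
  rw [if_neg (by omega)]
  by_cases h1 : k = 1
  · simp [h1]
  by_cases h2 : k = 2
  · by_cases hT : (-i).val < m <;> simp [h2, hT]
  by_cases h3 : k ≤ m + 1
  · have : 3 ≤ k := by omega
    simp [h1, h2, h3, this]
  · simp [h1, h2, h3]

lemma zz_bd2 {n k : ℕ} (h : k < n) : 0 ≤ zz n k ∧ zz n k < n := by
  unfold zz; split <;> omega

lemma zz_inj2 {n k k' : ℕ} (h : k < n) (h' : k' < n) (e : zz n k = zz n k') : k = k' := by
  unfold zz at e; split at e <;> split at e <;> omega

lemma Jcases {m : ℕ} (hm : 3 ≤ m) (T : Prop) [Decidable T] (k : ℕ) (h1 : 1 ≤ k) (h2 : k ≤ 2 * m) :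
    (k = 1 ∧ Jc m T k = true ∧ Jl m T k = 0) ∨
    (k = 2 ∧ Jc m T k = true ∧ Jl m T k = m) ∨
    (k = 2 ∧ Jc m T k = false ∧ Jl m T k = m + 1) ∨
    ((3 ≤ k ∧ k ≤ m + 1) ∧ Jc m T k = true ∧ Jl m T k = -1 - zz (m - 1) (k - 3) ∧
      0 ≤ zz (m - 1) (k - 3) ∧ zz (m - 1) (k - 3) < (m : ℤ) - 1) ∨
    (m + 2 ≤ k ∧ Jc m T k = false ∧ Jl m T k = (m : ℤ) - 2 - wd m - zz (m - 1) (k - m - 2) ∧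
      0 ≤ zz (m - 1) (k - m - 2) ∧ zz (m - 1) (k - m - 2) < (m : ℤ) - 1) := by
  by_cases e1 : k = 1
  · left; simp [e1, Jc, Jl]
  by_cases e2 : k = 2
  · by_cases hT : T
    · right; left; simp [e2, Jc, Jl, hT]
    · right; right; left; simp [e2, Jc, Jl, hT]
  by_cases e3 : k ≤ m + 1
  · right; right; right; left
    have := zz_bd2 (n := m - 1) (k := k - 3) (by omega)
    refine ⟨by omega, ?_, ?_, by omega, by omega⟩
    · simp [Jc]; omega
    · simp [Jl, e1, e2, e3]
  · right; right; right; right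
    have := zz_bd2 (n := m - 1) (k := k - m - 2) (by omega)
    refine ⟨by omega, ?_, ?_, by omega, by omega⟩
    · simp [Jc, e1, e2, e3]
    · simp [Jl, e1, e2, e3]

lemma J_inj {t m : ℕ} (hm : 3 ≤ m) (p : Fin t) (i : ZMod (2 * m + 1)) (k k' : ℕ) (hk : k < k')
    (hk' : k' < 2 * m + 1) : J p i k ≠ J p i k' := by
  by_cases h0 : k = 0
  · rw [J_eq p i k' (by omega)]
    simp [h0, J]
  rw [J_eq p i k' (by omega), J_eq p i k (by omega)]
  intro he
  simp only [Option.some.injEq, Prod.mk.injEq, add_right_inj, true_and] at he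
  obtain ⟨h1, h2⟩ := he
  have hw : 0 ≤ wd m ∧ wd m < m := by unfold wd; omega
  rcases Jcases hm ((-i).val < m) k (by omega) (by omega) with a | a | a | a | a <;>
  rcases Jcases hm ((-i).val < m) k' (by omega) (by omega) with b | b | b | b | b <;>
  first
  | (exfalso; rw [a.2.1, b.2.1] at h1; exact absurd h1 (by decide))
  | (have h3 := cast_inj h2 (by omega) (by omega)
     first
     | omega
     | (have h4 := zz_inj2 (n := m - 1) (k := k - 3) (k' := k' - 3) (by omega) (by omega) (by omega)
        omega)
     | (have h4 := zz_inj2 (n := m - 1) (k := k - m - 2) (k' := k' - m - 2)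
          (by omega) (by omega) (by omega)
        omega))

lemma J_red {t m : ℕ} (hm : 3 ≤ m) (p : Fin t) (i : ZMod (2 * m + 1)) :
    (∑ k ∈ Finset.range (2 * m + 1), if col (J p i k) = true then 1 else 0) = m ∨
    (∑ k ∈ Finset.range (2 * m + 1), if col (J p i k) = true then 1 else 0) = m + 1 := by
  have e : ∀ k, (col (J p i k) = true) ↔
      (k = 1 ∨ (k = 2 ∧ (-i).val < m) ∨ (3 ≤ k ∧ k ≤ m + 1)) := by
    intro k
    by_cases h0 : k = 0
    · subst h0
      simp [J, col]
    · rw [J_eq p i k (by omega)]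
      simp [col, Jc]
  simp only [e]
  rw [← Finset.card_filter]
  by_cases hT : (-i).val < m
  · right
    have : (Finset.range (2 * m + 1)).filter
        (fun k => k = 1 ∨ (k = 2 ∧ (-i).val < m) ∨ (3 ≤ k ∧ k ≤ m + 1)) = Finset.Icc 1 (m + 1) := by
      ext k
      simp only [Finset.mem_filter, Finset.mem_range, Finset.mem_Icc, hT, and_true]
      omega
    rw [this]; simp
  · left
    have : (Finset.range (2 * m + 1)).filter
        (fun k => k = 1 ∨ (k = 2 ∧ (-i).val < m) ∨ (3 ≤ k ∧ k ≤ m + 1)) =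
        (Finset.Icc 1 (m + 1)).erase 2 := by
      ext k
      simp only [Finset.mem_filter, Finset.mem_range, Finset.mem_Icc, hT, and_false,
        Finset.mem_erase, false_or]
      omega
    rw [this, Finset.card_erase_of_mem (by simp; omega)]; simp

/-! F-cycles -/

def F {t m : ℕ} (p : Fin t) (k : ℕ) : W t m :=
  some (p, decide (k % 2 = 0),
    (((if k % 2 = 0 then -((k / 2 : ℕ) : ℤ) else (m : ℤ) + 1 - ((k / 2 : ℕ) : ℤ)) : ℤ) :
      ZMod (2 * m + 1)))

lemma F_inj {t m : ℕ} (p : Fin t) (k k' : ℕ) (hk : k < k')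
    (hk' : k' < 2 * m + 1) : (F p k : W t m) ≠ F p k' := by
  intro he
  unfold F at he
  simp only [Option.some.injEq, Prod.mk.injEq, true_and, decide_eq_decide] at he
  obtain ⟨h1, h2⟩ := he
  by_cases h : k % 2 = 0
  · rw [if_pos h, if_pos (h1.1 h)] at h2
    have := cast_inj h2 (by omega) (by omega)
    omega
  · rw [if_neg h, if_neg (fun x => h (h1.2 x))] at h2
    have := cast_inj h2 (by omega) (by omega)
    omega

lemma F_red {t m : ℕ} (p : Fin t) :
    (∑ k ∈ Finset.range (2 * m + 1), if col (F p k : W t m) = true then 1 else 0) = m + 1 := by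
  have e : ∀ k, (col (F p k : W t m) = true) ↔ k % 2 = 0 := by
    intro k; simp [F, col]
  simp only [e]
  have : ∀ n, (∑ k ∈ Finset.range (2 * n + 1), if k % 2 = 0 then 1 else 0) = n + 1 := by
    intro n
    induction n with
    | zero => rw [Finset.sum_range_one, if_pos (by simp)]
    | succ n ih =>
      rw [show 2 * (n + 1) + 1 = 2 * n + 1 + 1 + 1 by ring, Finset.sum_range_succ,
        Finset.sum_range_succ, ih, if_neg (by omega), if_pos (by omega)]
  exact this m

/-! the family -/

abbrev Ix (t m : ℕ) : Type :=
  ((((q : Fin t) × Fin q.val) × Bool × Bool × ZMod (2 * m + 1)) ⊕ (Fin t × ZMod (2 * m + 1))) ⊕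
    ((Fin t × ZMod (2 * m + 1)) ⊕ Fin t)

def blk {t m : ℕ} (p q : Fin t) (a b : Bool) (i : ZMod (2 * m + 1)) : ℕ → W t m :=
  Z p q (tau m a b) (op (p, a) (q, b)) i

def P {t m : ℕ} (p : Fin t) (i : ZMod (2 * m + 1)) : ℕ → W t m :=
  Z p p (tauP m) (op (p, true) (p, false)) i

def fam {t m : ℕ} : Ix t m → ℕ → W t m
  | Sum.inl (Sum.inl (x, a, b, i)) => blk ⟨x.2.val, x.2.isLt.trans x.1.isLt⟩ x.1 a b i
  | Sum.inl (Sum.inr (p, i)) => P p i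
  | Sum.inr (Sum.inl (p, i)) => J p i
  | Sum.inr (Sum.inr p) => F p

lemma fam_inj {t m : ℕ} (hm : 3 ≤ m) (x : Ix t m) (k k' : ℕ) (hk : k < k')
    (hk' : k' < 2 * m + 1) : fam x k ≠ fam x k' := by
  rcases x with (⟨x, a, b, i⟩ | ⟨p, i⟩) | (⟨p, i⟩ | p)
  · refine Z_inj _ _ _ _ _ (Or.inl ?_) k k' hk hk'
    intro h
    have h1 := congrArg Fin.val h
    have h2 := x.2.isLt
    simp only at h1
    omega
  · exact Z_inj _ _ _ _ _ (Or.inr (tauP_ne m)) k k' hk hk'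
  · exact J_inj hm p i k k' hk hk'
  · exact F_inj p k k' hk hk'

lemma fam_red {t m : ℕ} (hm : 3 ≤ m) (x : Ix t m) :
    (∑ k ∈ Finset.range (2 * m + 1), if col (fam x k) = true then 1 else 0) = m ∨
    (∑ k ∈ Finset.range (2 * m + 1), if col (fam x k) = true then 1 else 0) = m + 1 := by
  rcases x with (⟨x, a, b, i⟩ | ⟨p, i⟩) | (⟨p, i⟩ | p)
  · exact Z_red _ _ _ _ _ (tau_sum m hm a b)
  · exact Z_red _ _ _ _ _ (tauP_sum m hm)
  · exact J_red hm p i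
  · exact Or.inr (F_red p)

lemma fam_card (t m : ℕ) :
    Fintype.card (Ix t m) * (2 * m + 1) = (Fintype.card (W t m)).choose 2 := by
  have h1 : Fintype.card ((q : Fin t) × Fin q.val) * 2 = t * (t - 1) := by
    rw [Fintype.card_sigma]
    simp only [Fintype.card_fin]
    rw [Fin.sum_univ_eq_sum_range (fun k => k) t, Finset.sum_range_id_mul_two]
  have h2 : Fintype.card (Ix t m) = Fintype.card ((q : Fin t) × Fin q.val) * (2 * (2 * (2 * m + 1)))
      + t * (2 * m + 1) + (t * (2 * m + 1) + t) := by
    simp only [Ix, Fintype.card_sum, Fintype.card_prod, Fintype.card_fin, ZMod.card,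
      Fintype.card_bool]
  have h3 : Fintype.card (W t m) = 2 * (t * (2 * m + 1)) + 1 := by
    simp only [W, Fintype.card_option, Fintype.card_prod, Fintype.card_fin, ZMod.card,
      Fintype.card_bool]
    ring
  rw [h2, h3, Nat.choose_two_right]
  symm
  apply Nat.div_eq_of_eq_mul_right (by norm_num)
  have h4 : Fintype.card ((q : Fin t) × Fin q.val) * 2 + t = t * t := by
    rw [h1]
    cases t with
    | zero => rfl
    | succ n => simp; ring
  simp only [Nat.add_sub_cancel]
  generalize Fintype.card ((q : Fin t) × Fin q.val) = N at h4
  zify at h4 ⊢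
  linear_combination (-4 * (2 * (m : ℤ) + 1) ^ 2) * h4

/-! coverage -/

def Cov {t m : ℕ} (u w : W t m) : Prop := ∃ x : Ix t m, s(u, w) ∈ cycEdges (mk m (fam x))

lemma Cov.symm {t m : ℕ} {u w : W t m} (h : Cov u w) : Cov w u := by
  obtain ⟨x, hx⟩ := h
  exact ⟨x, by rw [Sym2.eq_swap]; exact hx⟩

lemma cov_blk {t m : ℕ} {u w : W t m} (p q : Fin t) (h : p < q) (a b : Bool) (i : ZMod (2 * m + 1))
    (he : s(u, w) ∈ cycEdges (mk m (blk p q a b i))) : Cov u w :=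
  ⟨Sum.inl (Sum.inl (⟨q, ⟨p.val, h⟩⟩, a, b, i)), he⟩

lemma cov_P {t m : ℕ} {u w : W t m} (p : Fin t) (i : ZMod (2 * m + 1))
    (he : s(u, w) ∈ cycEdges (mk m (P p i))) : Cov u w :=
  ⟨Sum.inl (Sum.inr (p, i)), he⟩

lemma cov_J {t m : ℕ} {u w : W t m} (p : Fin t) (i : ZMod (2 * m + 1)) (k : ℕ) (hk : k < 2 * m)
    (hu : u = J p i k) (hw : w = J p i (k + 1)) : Cov u w :=
  ⟨Sum.inr (Sum.inl (p, i)), by rw [hu, hw]; exact mk_edge m _ k hk⟩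

lemma cov_F {t m : ℕ} {u w : W t m} (p : Fin t) (k : ℕ) (hk : k < 2 * m)
    (hu : u = F p k) (hw : w = F p (k + 1)) : Cov u w :=
  ⟨Sum.inr (Sum.inr p), by rw [hu, hw]; exact mk_edge m _ k hk⟩

lemma lev2 {t m : ℕ} (p : Fin t) (s : Bool) (a : ZMod (2 * m + 1)) (x y z : ℤ) (h : x = z - y) :
    (some (p, s, a + (x : ZMod (2 * m + 1))) : W t m) =
      some (p, s, a - (y : ZMod (2 * m + 1)) + (z : ZMod (2 * m + 1))) := by
  rw [lev a x y z h]

lemma cov_Jlast {t m : ℕ} {u w : W t m} (p : Fin t) (i : ZMod (2 * m + 1))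
    (hu : u = J p i (2 * m)) (hw : w = J p i 0) : Cov u w :=
  ⟨Sum.inr (Sum.inl (p, i)), by rw [hu, hw]; exact mk_edge_last m _⟩

lemma cov_Flast {t m : ℕ} {u w : W t m} (p : Fin t)
    (hu : u = F p (2 * m)) (hw : w = F p 0) : Cov u w :=
  ⟨Sum.inr (Sum.inr p), by rw [hu, hw]; exact mk_edge_last m _⟩

lemma two_m (m : ℕ) : 2 * (m : ZMod (2 * m + 1)) + 1 = 0 := by
  have := ZMod.natCast_self (2 * m + 1)
  push_cast at this
  exact this

lemma cov_inf {t m : ℕ} (hm : 3 ≤ m) (p : Fin t) (b : Bool) (i : ZMod (2 * m + 1)) :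
    Cov (none : W t m) (some (p, b, i)) := by
  cases b
  · let l : ℤ := (m : ℤ) - 2 - wd m - zz (m - 1) (2 * m - m - 2)
    refine Cov.symm (cov_Jlast p (i - (l : ZMod (2 * m + 1))) ?_ ?_)
    · unfold J
      rw [if_neg (by omega), if_neg (by omega), if_neg (by omega), if_neg (by omega),
        sub_add_cancel]
    · simp [J]
  · exact cov_J p i 0 (by omega) (by simp [J]) (by simp [J])

/-- cross difference `-m` -/
lemma cov_c1 {t m : ℕ} (hm : 3 ≤ m) (p : Fin t) (i : ZMod (2 * m + 1)) :
    Cov (some (p, true, i) : W t m) (some (p, false, i + (m + 1))) := by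
  by_cases h : (-i).val < m
  · have e : (((-i).val : ℕ) : ZMod (2 * m + 1)) = -i := ZMod.natCast_rightInverse (-i)
    refine cov_F p (2 * (-i).val) (by omega) ?_ ?_
    · unfold F
      rw [if_pos (by omega), Nat.mul_div_cancel_left _ (by norm_num)]
      simp [e]
    · unfold F
      rw [if_neg (by omega), show (2 * (-i).val + 1) / 2 = (-i).val by omega]
      have : (2 * (-i).val + 1) % 2 = 1 := by omega
      simp [e, this]
      ring
  · refine cov_J p i 1 (by omega) ?_ ?_
    · simp [J]
    · simp [J, h]

/-- cross difference `-(m-1)` -/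
lemma cov_c2 {t m : ℕ} (hm : 3 ≤ m) (p : Fin t) (i : ZMod (2 * m + 1)) :
    Cov (some (p, false, i + (m + 1)) : W t m) (some (p, true, i - 1)) := by
  by_cases h : (-i).val < m
  · have e : (((-i).val : ℕ) : ZMod (2 * m + 1)) = -i := ZMod.natCast_rightInverse (-i)
    refine cov_F p (2 * (-i).val + 1) (by omega) ?_ ?_
    · unfold F
      rw [if_neg (by omega), show (2 * (-i).val + 1) / 2 = (-i).val by omega]
      have : (2 * (-i).val + 1) % 2 = 1 := by omega
      simp [e, this]
      ring
    · unfold F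
      rw [if_pos (by omega), show (2 * (-i).val + 1 + 1) / 2 = (-i).val + 1 by omega]
      have : (2 * (-i).val + 1 + 1) % 2 = 0 := by omega
      simp [e, this]
      ring
  · refine cov_J p i 2 (by omega) ?_ ?_
    · simp [J, h]
    · have : 2 ≤ m := by omega
      simp [J, this, zz]
      ring

/-- pure red difference `m` -/
lemma cov_pm {t m : ℕ} (hm : 3 ≤ m) (p : Fin t) (j : ZMod (2 * m + 1)) :
    Cov (some (p, true, j) : W t m) (some (p, true, j + m)) := by
  have e : (((-j).val : ℕ) : ZMod (2 * m + 1)) = -j := ZMod.natCast_rightInverse (-j)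
  have hlt := ZMod.val_lt (-j)
  have h2 := two_m m
  rcases lt_trichotomy (-j).val m with h | h | h
  · refine cov_J p j 1 (by omega) ?_ ?_
    · simp [J]
    · simp [J, h]
  · rw [h] at e
    refine cov_Flast p ?_ ?_
    · simp [F, e]
    · simp [F, e]
  · have h3 : (-(j - m)).val = (-j).val - m - 1 := by
      have : -(j - (m : ZMod (2 * m + 1))) = (((-j).val - m - 1 : ℕ) : ZMod (2 * m + 1)) := by
        rw [Nat.sub_sub, Nat.cast_sub (by omega), e]
        push_cast
        linear_combination h2
      rw [this, ZMod.val_cast_of_lt (by omega)]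
    refine cov_J p (j - m) 2 (by omega) ?_ ?_
    · simp only [J]
      rw [h3]
      have : (-j).val - m - 1 < m := by omega
      simp [this]
    · have : 2 ≤ m := by omega
      simp [J, this, zz]
      linear_combination h2

lemma cov_apex {t m : ℕ} (hm : 3 ≤ m) (a c : Q t) (i : ZMod (2 * m + 1)) :
    Cov (some (a.1, a.2, i) : W t m) (some (c.1, c.2, i + m)) := by
  obtain ⟨b, rfl⟩ := op_surj a c
  obtain ⟨p, α⟩ := a
  obtain ⟨q, β⟩ := b
  rcases lt_trichotomy p q with h | h | h
  · refine cov_blk p q h α β i ?_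
    have := Z_first (by omega) p q (tau m α β) (op (p, α) (q, β)) i
    rw [tau_zero] at this
    exact this
  · subst h
    by_cases hab : α = β
    · subst hab
      rw [op_diag]
      cases α
      · have := cov_c1 hm p (i + m)
        have e : i + m + (m + 1) = i := by linear_combination two_m m
        rw [e] at this
        exact this.symm
      · exact cov_pm hm p i
    · cases α
      · have : β = true := by cases β <;> simp_all
        subst this
        rw [op_comm]
        refine cov_P p i ?_
        have := Z_last (by omega) p p (tauP m) (op (p, true) (p, false)) i
        have e : tauP m (2 * m - 1) = false := by
          simp only [tauP, decide_eq_false_iff_not]; omega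
        rw [e] at this
        exact this
      · have : β = false := by cases β <;> simp_all
        subst this
        refine cov_P p i ?_
        have := Z_first (by omega) p p (tauP m) (op (p, true) (p, false)) i
        have e : tauP m 0 = true := by simp [tauP]
        rw [e] at this
        exact this
  · refine cov_blk q p h β α i ?_
    have := Z_last (by omega) q p (tau m β α) (op (q, β) (p, α)) i
    rw [tau_last m hm] at this
    rw [op_comm (p, α)]
    exact this

lemma cov_lt {t m : ℕ} (hm : 3 ≤ m) (p q : Fin t) (h : p < q) (s s' : Bool)
    (a b : ZMod (2 * m + 1)) : Cov (some (p, s, a) : W t m) (some (q, s', b)) := by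
  obtain ⟨z, hz, h1, h2⟩ := exists_rep (b - a)
  have hb : b = a + (z : ZMod (2 * m + 1)) := by rw [hz]; ring
  by_cases e1 : z = m
  · have := cov_apex hm (p, s) (q, s') a
    rw [hb, e1]
    simpa using this
  by_cases e2 : z = -m
  · have := cov_apex hm (q, s') (p, s) b
    have ha : b + (m : ZMod (2 * m + 1)) = a := by rw [hb, e2]; push_cast; ring
    rw [ha] at this
    exact this.symm
  obtain ⟨k, hk⟩ : ∃ k : ℕ, (k : ℤ) = m - 1 - z := ⟨((m : ℤ) - 1 - z).toNat, by omega⟩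
  have hb' : b = a + (((m : ℤ) - 1 - k : ℤ) : ZMod (2 * m + 1)) := by
    rw [hb]; congr 2; omega
  by_cases hp : k % 2 = 0
  · obtain ⟨α, β, h3, h4⟩ := tau_cons m k s s'
    obtain ⟨i, hi⟩ := Z_cover p q (tau m α β) (op (p, α) (q, β)) k (by omega) a b hb' s s'
      (by rw [if_pos hp, h3]) (by rw [if_pos hp, h4])
    exact cov_blk p q h α β i hi
  · obtain ⟨α, β, h3, h4⟩ := tau_cons m k s' s
    obtain ⟨i, hi⟩ := Z_cover p q (tau m α β) (op (p, α) (q, β)) k (by omega) a b hb' s s'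
      (by rw [if_neg hp, h4]) (by rw [if_neg hp, h3])
    exact cov_blk p q h α β i hi

lemma J_x {t m : ℕ} (p : Fin t) (i : ZMod (2 * m + 1)) (r : ℕ) (hr : r + 2 ≤ m) :
    J p i (r + 3) = some (p, true, i + ((-1 - zz (m - 1) r : ℤ) : ZMod (2 * m + 1))) := by
  unfold J
  rw [if_neg (by omega), if_neg (by omega), if_neg (by omega), if_pos (by omega)]
  rfl

lemma J_y {t m : ℕ} (p : Fin t) (i : ZMod (2 * m + 1)) (r : ℕ) (hm : 3 ≤ m) :
    J p i (r + m + 2) = some (p, false, i + (((m : ℤ) - 2 - wd m - zz (m - 1) r : ℤ) :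
      ZMod (2 * m + 1))) := by
  unfold J
  rw [if_neg (by omega), if_neg (by omega), if_neg (by omega), if_neg (by omega),
    show r + m + 2 - m - 2 = r by omega]

lemma zz_step (n r : ℕ) : (r % 2 = 0 → zz n (r + 1) = zz n r + (n - 1 - r)) ∧
    (r % 2 ≠ 0 → zz n r = zz n (r + 1) + (n - 1 - r)) := by
  unfold zz
  constructor <;> intro h
  · rw [if_neg (by omega), if_pos h]; omega
  · rw [if_neg h, if_pos (by omega)]; omega

lemma cov_pure {t m : ℕ} (hm : 3 ≤ m) (p : Fin t) (s : Bool) (a : ZMod (2 * m + 1)) (d : ℕ)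
    (h1 : 1 ≤ d) (h2 : d ≤ m) : Cov (some (p, s, a) : W t m) (some (p, s, a + d)) := by
  by_cases e1 : d = m
  · rw [e1]; exact cov_apex hm (p, s) (p, s) a
  by_cases e2 : d = m - 1
  · cases s
    · obtain ⟨i, hi⟩ := Z_cover p p (tauP m) (op (p, true) (p, false)) (2 * m - 2) (by omega)
        (a + (d : ZMod (2 * m + 1))) a (by
          rw [e2]
          have : (m : ℤ) - 1 - ((2 * m - 2 : ℕ) : ℤ) = -((m - 1 : ℕ) : ℤ) := by omega
          rw [this]; push_cast; ring) false false
        (by symm; simp only [tauP, decide_eq_false_iff_not]; split <;> omega)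
        (by symm; simp only [tauP, decide_eq_false_iff_not]; split <;> omega)
      exact (cov_P p i hi).symm
    · obtain ⟨i, hi⟩ := Z_cover p p (tauP m) (op (p, true) (p, false)) 0 (by omega)
        a (a + (d : ZMod (2 * m + 1))) (by
          rw [e2]
          have : (m : ℤ) - 1 - ((0 : ℕ) : ℤ) = ((m - 1 : ℕ) : ℤ) := by omega
          rw [this]; push_cast; ring) true true
        (by symm; simp only [tauP, decide_eq_true_eq]; split <;> omega)
        (by symm; simp only [tauP, decide_eq_true_eq]; split <;> omega)
      exact cov_P p i hi
  obtain ⟨r, hr⟩ : ∃ r : ℕ, r + d + 2 = m := ⟨m - d - 2, by omega⟩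
  have hd : ((d : ℕ) : ZMod (2 * m + 1)) = (((d : ℕ) : ℤ) : ZMod (2 * m + 1)) := by simp
  have st := zz_step (m - 1) r
  have hc : (((m - 1 : ℕ) : ℤ) - 1 - r) = d := by omega
  rw [hc] at st
  cases s
  · by_cases hp : r % 2 = 0
    · have st' := st.1 hp
      apply Cov.symm
      refine cov_J p (a - ((((m : ℤ) - 2 - wd m - zz (m - 1) (r + 1)) : ℤ) : ZMod (2 * m + 1)))
        (r + m + 2) (by omega) ?_ ?_
      · rw [J_y p _ r hm, hd]
        exact lev2 _ _ a _ _ _ (by rw [st']; ring)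
      · rw [show r + m + 2 + 1 = (r + 1) + m + 2 by ring, J_y p _ (r + 1) hm, sub_add_cancel]
    · have st' := st.2 hp
      refine cov_J p (a - ((((m : ℤ) - 2 - wd m - zz (m - 1) r) : ℤ) : ZMod (2 * m + 1)))
        (r + m + 2) (by omega) ?_ ?_
      · rw [J_y p _ r hm, sub_add_cancel]
      · rw [show r + m + 2 + 1 = (r + 1) + m + 2 by ring, J_y p _ (r + 1) hm, hd]
        exact lev2 _ _ a _ _ _ (by rw [st']; ring)
  · by_cases hp : r % 2 = 0
    · have st' := st.1 hp
      apply Cov.symm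
      refine cov_J p (a - ((-1 - zz (m - 1) (r + 1) : ℤ) : ZMod (2 * m + 1)))
        (r + 3) (by omega) ?_ ?_
      · rw [J_x p _ r (by omega), hd]
        exact lev2 _ _ a _ _ _ (by rw [st']; ring)
      · rw [show r + 3 + 1 = (r + 1) + 3 by ring, J_x p _ (r + 1) (by omega), sub_add_cancel]
    · have st' := st.2 hp
      refine cov_J p (a - ((-1 - zz (m - 1) r : ℤ) : ZMod (2 * m + 1)))
        (r + 3) (by omega) ?_ ?_
      · rw [J_x p _ r (by omega), sub_add_cancel]
      · rw [show r + 3 + 1 = (r + 1) + 3 by ring, J_x p _ (r + 1) (by omega), hd]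
        exact lev2 _ _ a _ _ _ (by rw [st']; ring)

lemma cov_same {t m : ℕ} (hm : 3 ≤ m) (p : Fin t) (s : Bool) (a b : ZMod (2 * m + 1)) (h : a ≠ b) :
    Cov (some (p, s, a) : W t m) (some (p, s, b)) := by
  obtain ⟨z, hz, h1, h2⟩ := exists_rep (b - a)
  have hb : b = a + (z : ZMod (2 * m + 1)) := by rw [hz]; ring
  rcases lt_trichotomy z 0 with h0 | h0 | h0
  · obtain ⟨d, hd⟩ : ∃ d : ℕ, (d : ℤ) = -z := ⟨(-z).toNat, by omega⟩
    have ha : a = b + (d : ZMod (2 * m + 1)) := by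
      have := congrArg (fun x : ℤ => (x : ZMod (2 * m + 1))) hd
      simp only [Int.cast_natCast, Int.cast_neg] at this
      rw [this, hb]; ring
    have := cov_pure hm p s b d (by omega) (by omega)
    rw [← ha] at this
    exact this.symm
  · subst h0; simp at hb; exact absurd hb.symm h
  · obtain ⟨d, hd⟩ : ∃ d : ℕ, (d : ℤ) = z := ⟨z.toNat, by omega⟩
    have ha : b = a + (d : ZMod (2 * m + 1)) := by
      rw [hb, ← hd]; simp
    have := cov_pure hm p s a d (by omega) (by omega)
    rw [← ha] at this
    exact this

lemma cov_cross {t m : ℕ} (hm : 3 ≤ m) (p : Fin t) (a b : ZMod (2 * m + 1)) :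
    Cov (some (p, true, a) : W t m) (some (p, false, b)) := by
  obtain ⟨z, hz, h1, h2⟩ := exists_rep (b - a)
  have hb : b = a + (z : ZMod (2 * m + 1)) := by rw [hz]; ring
  by_cases e1 : z = m
  · have := cov_apex hm (p, true) (p, false) a
    rw [hb, e1]
    simpa using this
  by_cases e2 : z = -m
  · have := cov_apex hm (p, false) (p, true) b
    have ha : b + (m : ZMod (2 * m + 1)) = a := by rw [hb, e2]; push_cast; ring
    rw [ha] at this
    exact this.symm
  by_cases e3 : z = m - 1
  · have hw : zz (m - 1) (m - 2) = wd m := by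
      unfold zz wd; split <;> omega
    refine cov_J p (a - ((-1 - zz (m - 1) (m - 2) : ℤ) : ZMod (2 * m + 1))) (m + 1) (by omega) ?_ ?_
    · have := J_x p (a - ((-1 - zz (m - 1) (m - 2) : ℤ) : ZMod (2 * m + 1))) (m - 2) (by omega)
      rw [show m - 2 + 3 = m + 1 by omega] at this
      rw [this, sub_add_cancel]
    · have := J_y p (a - ((-1 - zz (m - 1) (m - 2) : ℤ) : ZMod (2 * m + 1))) 0 hm
      rw [show 0 + m + 2 = m + 1 + 1 by omega] at this
      rw [this, hb]
      exact lev2 _ _ a _ _ _ (by rw [hw, e3]; simp [zz]; ring)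
  by_cases e4 : z = -(m - 1)
  · have := cov_c2 hm p (a + 1)
    have e : a + 1 + (m + 1) = b := by
      rw [hb, e4]; push_cast; linear_combination two_m m
    rw [e, add_sub_cancel_right] at this
    exact this.symm
  obtain ⟨k, hk⟩ : ∃ k : ℕ, (k : ℤ) = m - 1 + z := ⟨((m : ℤ) - 1 + z).toNat, by omega⟩
  obtain ⟨i, hi⟩ := Z_cover p p (tauP m) (op (p, true) (p, false)) k (by omega) b a
    (by
      have : (m : ℤ) - 1 - k = -z := by omega
      rw [this, hb]; push_cast; ring) false true
    (by
      symm; simp only [tauP, decide_eq_false_iff_not]; split <;> omega)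
    (by
      symm; simp only [tauP, decide_eq_true_eq]; split <;> omega)
  exact (cov_P p i hi).symm

lemma cov_all {t m : ℕ} (hm : 3 ≤ m) (u w : W t m) (h : u ≠ w) : Cov u w := by
  rcases u with _ | ⟨p, s, a⟩
  · rcases w with _ | ⟨q, s', b⟩
    · exact absurd rfl h
    · exact cov_inf hm q s' b
  · rcases w with _ | ⟨q, s', b⟩
    · exact (cov_inf hm p s a).symm
    · rcases lt_trichotomy p q with hl | hl | hl
      · exact cov_lt hm p q hl s s' a b
      · subst hl
        cases s <;> cases s'
        · exact cov_same hm p _ a b (fun e => h (by rw [e]))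
        · exact (cov_cross hm p b a).symm
        · exact cov_cross hm p a b
        · exact cov_same hm p _ a b (fun e => h (by rw [e]))
      · exact (cov_lt hm q p hl s' s b a).symm

lemma main (t m : ℕ) (hm : 3 ≤ m) :
    HasEquitable2Decomp (⊤ : SimpleGraph (Fin (2 * (2 * m + 1) * t + 1))) (2 * m + 1) := by
  have h := decomp_of_surj (V := W t m) (ι := Ix t m) m (by omega) fam col (fam_inj hm)
    (cov_all hm) (fam_card t m) (fam_red hm)
  refine transfer _ (Fintype.equivFinOfCardEq ?_) h
  simp only [W, Fintype.card_option, Fintype.card_prod, Fintype.card_fin, ZMod.card,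
    Fintype.card_bool]
  ring

end EqCyc

theorem stmt14 (ℓ v : ℕ) (hℓ : 7 ≤ ℓ) (hodd : Odd ℓ) (hv : 0 < v)
    (hmod : v % (2 * ℓ) = 1) :
    letI : NeZero ℓ := ⟨by omega⟩
    HasEquitable2Decomp (⊤ : SimpleGraph (Fin v)) ℓ := by
  obtain ⟨m, rfl⟩ := hodd
  obtain ⟨t, rfl⟩ : ∃ t, v = 2 * (2 * m + 1) * t + 1 := by
    refine ⟨v / (2 * (2 * m + 1)), ?_⟩
    have := Nat.div_add_mod v (2 * (2 * m + 1))
    rw [hmod] at this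
    exact this.symm
  exact EqCyc.main t m (by omega)
end
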